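/- arXiv:1809.09178 — 3 statements merged into one kernel-verified Lean document; each statement's English description precedes it below -/
import Mathlib

section
/- Let Ω ⊆ ℝ³ be a connected, simply connected open set and let ε be a twice continuously differentiable symmetric 3×3 matrix field on Ω satisfying the St.-Venant compatibility condition. Then there exists a three times continuously differentiable map u : Ω → ℝ³ such that ½(∂_j u_i + ∂_i u_j) = ε_{ij} on Ω for all i,j ∈ {1,2,3}. -/
noncomputable section

open Matrix

/-- Points of 3-d Euclidean space, as triples of reals. -/
abbrev E3 : Type := Fin 3 → ℝ

/-- Partial derivative `∂_j f` of a scalar field `f` at `x`. -/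
noncomputable def pd (j : Fin 3) (f : E3 → ℝ) (x : E3) : ℝ :=
  fderiv ℝ f x (Pi.single j 1)

/-- The St.-Venant compatibility condition for a matrix field `ε` on `Ω`:
`ε_{il,km} − ε_{kl,im} − ε_{im,kl} + ε_{km,il} = 0` on `Ω` for all indices. -/
def StVenant (ε : Fin 3 → Fin 3 → E3 → ℝ) (Ω : Set E3) : Prop :=
  ∀ x ∈ Ω, ∀ i k l m : Fin 3,
    pd m (pd k (ε i l)) x - pd m (pd i (ε k l)) x
      - pd l (pd k (ε i m)) x + pd l (pd i (ε k m)) x = 0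

/-- The real numbers with the discrete topology. -/
def DR : Type := ℝ

instance : TopologicalSpace DR := ⊥

instance : DiscreteTopology DR := ⟨rfl⟩

/-- The bundle of local primitives of a closed form. -/
def primCore (Ω : Set E3) (ω : E3 → E3 →L[ℝ] ℝ)
    (r : Ω → ℝ) (hr : ∀ x, 0 < r x)
    (f : Ω → E3 → ℝ)
    (hf : ∀ x : Ω, ∀ y ∈ Metric.ball (x : E3) (r x), HasFDerivAt (f x) (ω y) y) :
    FiberBundleCore Ω Ω DR where
  baseSet i := Subtype.val ⁻¹' Metric.ball (i : E3) (r i)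
  isOpen_baseSet i := Metric.isOpen_ball.preimage continuous_subtype_val
  indexAt x := x
  mem_baseSet_at x := Metric.mem_ball_self (hr x)
  coordChange i j x v := show ℝ from (show ℝ from v) + (f i x - f j x)
  coordChange_self i x hx v := by
    change (show ℝ from v) + (f i x - f i x) = (show ℝ from v)
    ring
  continuousOn_coordChange i j := by
    rcases Set.eq_empty_or_nonempty ((Subtype.val ⁻¹' Metric.ball (i : E3) (r i) ∩
      Subtype.val ⁻¹' Metric.ball (j : E3) (r j) : Set Ω)) with h | ⟨x₀, hx₀⟩
    · rw [h, Set.empty_prod]; exact continuousOn_empty _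
    · have hc : Continuous (fun p : Ω × DR =>
          (show DR from ((show ℝ from p.2) + (f i x₀ - f j x₀) : ℝ))) := by
        exact (continuous_of_discreteTopology (f := fun v : DR =>
          (show DR from ((show ℝ from v) + (f i x₀ - f j x₀) : ℝ)))).comp continuous_snd
      refine hc.continuousOn.congr ?_
      rintro ⟨x, v⟩ ⟨hx, -⟩
      have key : (f i - f j) x = (f i - f j) x₀ := by
        have hconv : Convex ℝ (Metric.ball (i : E3) (r i) ∩ Metric.ball (j : E3) (r j)) :=
          (convex_ball _ _).inter (convex_ball _ _)
        have hd : ∀ y ∈ Metric.ball (i : E3) (r i) ∩ Metric.ball (j : E3) (r j),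
            HasFDerivAt (f i - f j) 0 y := fun y hy => by
          simpa using (hf i y hy.1).sub (hf j y hy.2)
        refine (Metric.isOpen_ball.inter Metric.isOpen_ball).is_const_of_fderiv_eq_zero (𝕜 := ℝ)
          hconv.isPreconnected
          (fun y hy => (hd y hy).differentiableAt.differentiableWithinAt)
          (fun y hy => (hd y hy).fderiv) hx hx₀
      change (show ℝ from v) + (f i x - f j x) = (show ℝ from v) + (f i x₀ - f j x₀)
      simp only [Pi.sub_apply] at key
      rw [key]
  coordChange_comp i j k x _ v := by
    change ((show ℝ from v) + (f i x - f j x)) + (f j x - f k x) =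
      (show ℝ from v) + (f i x - f k x)
    ring

/-- A form that has primitives locally has a primitive on a simply connected open set. -/
theorem exists_primitive (Ω : Set E3) (hΩ : IsOpen Ω) [SimplyConnectedSpace Ω]
    (ω : E3 → E3 →L[ℝ] ℝ) (hω : DifferentiableOn ℝ ω Ω)
    (hdω : ∀ a ∈ Ω, ∀ x y, fderiv ℝ ω a x y = fderiv ℝ ω a y x) :
    ∃ f : E3 → ℝ, ∀ a ∈ Ω, HasFDerivAt f (ω a) a := by
  classical
  have h1 : ∀ x : Ω, ∃ r > 0, Metric.ball (x : E3) r ⊆ Ω := fun x =>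
    Metric.isOpen_iff.1 hΩ x x.2
  choose r hr hball using h1
  have h2 : ∀ x : Ω, ∃ f : E3 → ℝ, ∀ y ∈ Metric.ball (x : E3) (r x),
      HasFDerivAt f (ω y) y := fun x =>
    (convex_ball (x : E3) (r x)).exists_forall_hasFDerivAt_of_fderiv_symmetric
      Metric.isOpen_ball (hω.mono (hball x)) (fun a ha => hdω a (hball x ha))
  choose f hf using h2
  let Z := primCore Ω ω r hr f hf
  have cov : IsCoveringMap (Bundle.TotalSpace.proj : Bundle.TotalSpace DR Z.Fiber → Ω) :=
    FiberBundle.isCoveringMap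
  have : LocallyPathConnectedSpace Ω := hΩ.locallyPathConnectedSpace
  obtain ⟨x₀⟩ : Nonempty Ω := inferInstance
  obtain ⟨s, ⟨-, hs⟩, -⟩ := cov.existsUnique_continuousMap_lifts (ContinuousMap.id Ω) x₀
    (⟨x₀, (show DR from (0 : ℝ))⟩) rfl
  have hsp : ∀ x, (s x).proj = x := fun x => congrFun hs x
  -- coordinate of the section in chart `i`
  let v : Ω → Ω → ℝ := fun i x => (Z.localTriv i (s x)).2
  have hv : ∀ i x, v i x = v x x + (f x x - f i x) := by
    intro i x
    have e1 : ∀ j, v j x = (show ℝ from (s x).2) + (f (s x).proj (s x).proj - f j (s x).proj) :=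
      fun j => rfl
    rw [e1 i, e1 x, hsp x]
    ring
  refine ⟨fun y => if h : y ∈ Ω then v ⟨y, h⟩ ⟨y, h⟩ + f ⟨y, h⟩ y else 0, fun a ha => ?_⟩
  let i : Ω := ⟨a, ha⟩
  have hcont : ContinuousAt (fun x : Ω => (Z.localTriv i (s x)).2) i := by
    have hsrc : s i ∈ (Z.localTriv i).source := by
      rw [Z.mem_localTriv_source]
      change (s i).proj ∈ Z.baseSet i
      rw [hsp i]
      exact Z.mem_baseSet_at i
    exact continuousAt_snd.comp
      (((Z.localTriv i).continuousAt hsrc).comp s.continuous.continuousAt)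
  have hev : ∀ᶠ x : Ω in nhds i, v i x = v i i := by
    have := hcont (show {(Z.localTriv i (s i)).2} ∈ nhds (Z.localTriv i (s i)).2 from
      (isOpen_discrete _).mem_nhds rfl)
    exact this
  have hev2 : ∀ᶠ y in nhds a, ∀ h : y ∈ Ω, v i ⟨y, h⟩ = v i i := by
    rw [nhds_subtype_eq_comap] at hev
    obtain ⟨t, ht, hts⟩ := Filter.mem_comap.1 hev
    filter_upwards [ht] with y hy h
    exact hts (show (⟨y, h⟩ : Ω) ∈ _ from hy)
  have hd := (hf i a (Metric.mem_ball_self (hr i))).const_add (v i i)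
  refine hd.congr_of_eventuallyEq ?_
  filter_upwards [hev2, hΩ.mem_nhds ha] with y hy hyΩ
  have e := hv i ⟨y, hyΩ⟩
  rw [hy hyΩ] at e
  simp only [hyΩ, dif_pos]
  rw [e]
  change _ = _ + (f ⟨y, hyΩ⟩ y - f i y) + f i y
  ring

/-- Coordinate version of the Poincaré lemma. -/
theorem poincare_coord (Ω : Set E3) (hΩ : IsOpen Ω) [SimplyConnectedSpace Ω]
    (n : ℕ) (hn : 1 ≤ n) (g : Fin 3 → E3 → ℝ) (hg : ∀ i, ContDiffOn ℝ n (g i) Ω)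
    (hc : ∀ x ∈ Ω, ∀ i j, pd j (g i) x = pd i (g j) x) :
    ∃ f : E3 → ℝ, ContDiffOn ℝ (n + 1 : ℕ) f Ω ∧ ∀ x ∈ Ω, ∀ i, pd i f x = g i x := by
  let P : Fin 3 → E3 →L[ℝ] ℝ := fun i => ContinuousLinearMap.proj i
  let ω : E3 → E3 →L[ℝ] ℝ := fun x => ∑ i, g i x • P i
  have hωc : ContDiffOn ℝ n ω Ω :=
    ContDiffOn.sum fun i _ => (hg i).smul contDiffOn_const
  have hgd : ∀ i, ∀ x ∈ Ω, DifferentiableAt ℝ (g i) x := fun i x hx =>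
    ((hg i).differentiableOn (by exact_mod_cast (by omega : n ≠ 0))).differentiableAt (hΩ.mem_nhds hx)
  have hdec : ∀ (L : E3 →L[ℝ] ℝ) (v : E3), L v = ∑ j, v j * L (Pi.single j 1) := by
    intro L v
    conv_lhs => rw [pi_eq_sum_univ' v]
    simp [map_sum]
  have hdω : ∀ a ∈ Ω, ∀ x y, fderiv ℝ ω a x y = fderiv ℝ ω a y x := by
    intro a ha x y
    have hD : HasFDerivAt ω (∑ i, (fderiv ℝ (g i) a).smulRight (P i)) a :=
      HasFDerivAt.fun_sum fun i _ => (hgd i a ha).hasFDerivAt.smul_const (P i)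
    rw [hD.fderiv]
    have e : ∀ i (v : E3), fderiv ℝ (g i) a v = ∑ j, v j * pd j (g i) a := fun i v => hdec _ v
    simp only [_root_.sum_apply, ContinuousLinearMap.smulRight_apply,
      _root_.smul_apply, e, P, ContinuousLinearMap.proj_apply, smul_eq_mul]
    simp only [Fin.sum_univ_three]
    rw [hc a ha 0 1, hc a ha 0 2, hc a ha 1 2]
    ring
  obtain ⟨f, hf⟩ := exists_primitive Ω hΩ ω
    (hωc.differentiableOn (by exact_mod_cast (by omega : n ≠ 0))) hdω
  refine ⟨f, ?_, fun x hx i => ?_⟩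
  · push_cast
    rw [contDiffOn_succ_iff_fderiv_of_isOpen hΩ]
    exact ⟨fun x hx => (hf x hx).differentiableAt.differentiableWithinAt, by simp,
      hωc.congr fun x hx => (hf x hx).fderiv⟩
  · simp only [pd, (hf x hx).fderiv, ω, P]
    simp [Pi.single_apply]

theorem pd_contDiffOn (Ω : Set E3) (hΩ : IsOpen Ω) (f : E3 → ℝ) (hf : ContDiffOn ℝ 2 f Ω)
    (k : Fin 3) : ContDiffOn ℝ 1 (pd k f) Ω :=
  (hf.fderiv_of_isOpen hΩ (by norm_num)).clm_apply contDiffOn_const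

theorem pd_sub' (k : Fin 3) (f g : E3 → ℝ) (x : E3) (hf : DifferentiableAt ℝ f x)
    (hg : DifferentiableAt ℝ g x) :
    pd k (fun y => f y - g y) x = pd k f x - pd k g x := by
  simp [pd, fderiv_fun_sub hf hg]

theorem pd_add' (k : Fin 3) (f g : E3 → ℝ) (x : E3) (hf : DifferentiableAt ℝ f x)
    (hg : DifferentiableAt ℝ g x) :
    pd k (fun y => f y + g y) x = pd k f x + pd k g x := by
  simp [pd, fderiv_fun_add hf hg]

theorem pd_div_two (k : Fin 3) (f : E3 → ℝ) (x : E3) (hf : DifferentiableAt ℝ f x) :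
    pd k (fun y => f y / 2) x = pd k f x / 2 := by
  have := (hf.hasFDerivAt.mul_const (2⁻¹ : ℝ)).fderiv
  simp only [pd, div_eq_mul_inv, this]
  simp [mul_comm]

/-- On a connected, simply connected open set `Ω ⊆ ℝ³`, any C² symmetric matrix field `ε`
satisfying the St.-Venant compatibility condition is the strain of some C³ displacement
field `u`, i.e. `½(∂_j u_i + ∂_i u_j) = ε_{ij}` on `Ω`. -/
theorem weingarten_stmt3 (Ω : Set E3) (hΩ : IsOpen Ω) (hconn : IsConnected Ω)
    (hsc : SimplyConnectedSpace Ω)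
    (ε : Fin 3 → Fin 3 → E3 → ℝ)
    (hreg : ∀ i j, ContDiffOn ℝ 2 (ε i j) Ω)
    (hsym : ∀ i j, ∀ x ∈ Ω, ε i j x = ε j i x)
    (hSV : StVenant ε Ω) :
    ∃ u : E3 → E3, ContDiffOn ℝ 3 u Ω ∧
      ∀ x ∈ Ω, ∀ i j : Fin 3,
        (pd j (fun y => u y i) x + pd i (fun y => u y j) x) / 2 = ε i j x := by
  have hdiff : ∀ (f : E3 → ℝ) (n : ℕ), n ≠ 0 → ContDiffOn ℝ n f Ω →
      ∀ x ∈ Ω, DifferentiableAt ℝ f x := fun f n hn hf x hx =>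
    (hf.differentiableOn (by exact_mod_cast hn)).differentiableAt (hΩ.mem_nhds hx)
  have hpd1 := fun i j k => pd_contDiffOn Ω hΩ (ε i j) (hreg i j) k
  have hpdd := fun i j k => hdiff _ 1 one_ne_zero (by exact_mod_cast hpd1 i j k)
  have hεd := fun i j => hdiff _ 2 two_ne_zero (by exact_mod_cast hreg i j)
  -- the rotation
  have hw : ∀ i k : Fin 3, ∃ w : E3 → ℝ, ContDiffOn ℝ (1 + 1 : ℕ) w Ω ∧
      ∀ x ∈ Ω, ∀ l, pd l w x = pd k (ε i l) x - pd i (ε k l) x := by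
    intro i k
    refine poincare_coord Ω hΩ 1 le_rfl (fun l x => pd k (ε i l) x - pd i (ε k l) x) ?_ ?_
    · intro l
      exact_mod_cast (hpd1 i l k).sub (hpd1 k l i)
    · intro x hx l m
      rw [pd_sub' _ _ _ _ (hpdd i l k x hx) (hpdd k l i x hx),
        pd_sub' _ _ _ _ (hpdd i m k x hx) (hpdd k m i x hx)]
      linarith [hSV x hx i k l m]
  choose w hwc hw using hw
  have hwd := fun i k => hdiff _ _ (by norm_num) (hwc i k)
  have hu : ∀ i : Fin 3, ∃ u : E3 → ℝ, ContDiffOn ℝ (2 + 1 : ℕ) u Ω ∧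
      ∀ x ∈ Ω, ∀ k, pd k u x = ε i k x + (w i k x - w k i x) / 2 := by
    intro i
    refine poincare_coord Ω hΩ 2 one_le_two (fun k x => ε i k x + (w i k x - w k i x) / 2) ?_ ?_
    · intro k
      have h1 : ContDiffOn ℝ (2 : ℕ) (ε i k) Ω := by exact_mod_cast hreg i k
      exact h1.add (((hwc i k).sub (hwc k i)).div_const 2)
    · intro x hx k l
      have hs : ∀ a b c, pd c (ε a b) x = pd c (ε b a) x := by
        intro a b c
        have : ε a b =ᶠ[nhds x] ε b a := by
          filter_upwards [hΩ.mem_nhds hx] with y hy using hsym a b y hy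
        simp only [pd, this.fderiv_eq]
      have e : ∀ k l, pd l (fun y => ε i k y + (w i k y - w k i y) / 2) x =
          pd l (ε i k) x + (pd k (ε i l) x - pd i (ε k l) x) := by
        intro k l
        have hd := (hwd i k x hx).fun_sub (hwd k i x hx)
        have hd2 : DifferentiableAt ℝ (fun y => (w i k y - w k i y) / 2) x := by
          simpa only [div_eq_mul_inv] using hd.mul_const (2 : ℝ)⁻¹
        rw [pd_add' _ _ _ _ (hεd i k x hx) hd2, pd_div_two _ _ _ hd,
          pd_sub' _ _ _ _ (hwd i k x hx) (hwd k i x hx), hw i k x hx, hw k i x hx]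
        ring
      rw [e, e, hs l k i]
      ring
  choose u huc hu using hu
  refine ⟨fun x i => u i x, contDiffOn_pi.2 fun i => by exact_mod_cast huc i, ?_⟩
  intro x hx i j
  change (pd j (u i) x + pd i (u j) x) / 2 = ε i j x
  rw [hu i x hx j, hu j x hx i, hsym j i x hx]
  ring
end
end

section
/- Let Ω ⊆ ℝ³ be an open set and let y : Ω → ℝ³ be three times continuously differentiable with Dy(x) invertible for every x ∈ Ω. Define C(x) := (Dy(x))ᵀ Dy(x), a twice continuously differentiable positive-definite symmetric matrix field, with Christoffel symbols Γ. Then the Riemann–Christoffel curvature of C vanishes on Ω: Γ^μ_{αβ,ρ} − Γ^μ_{αρ,β} + Σ_γ (Γ^μ_{γρ} Γ^γ_{αβ} − Γ^μ_{γβ} Γ^γ_{αρ}) = 0 for all μ,α,β,ρ ∈ {1,2,3}. -/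
noncomputable section

open Matrix

/-- The Jacobian matrix `Dy(x)` of a map `y : ℝ³ → ℝ³`, with entries `(Dy)_{iα} = ∂_α y^i`. -/
noncomputable def jac (y : E3 → E3) (x : E3) : Matrix (Fin 3) (Fin 3) ℝ :=
  Matrix.of fun i α => pd α (fun z => y z i) x

/-- The Christoffel symbols `Γ^γ_{αβ}` of a positive-definite symmetric matrix field `C`:
`Γ^γ_{αβ} = ½ Σ_μ (C⁻¹)^{γμ}(C_{αμ,β} + C_{βμ,α} − C_{αβ,μ})`. -/
noncomputable def christoffel (C : E3 → Matrix (Fin 3) (Fin 3) ℝ)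
    (γ α β : Fin 3) (x : E3) : ℝ :=
  (1 / 2) * ∑ μ, (C x)⁻¹ γ μ *
    (pd β (fun y => C y α μ) x + pd α (fun y => C y β μ) x - pd μ (fun y => C y α β) x)

lemma pd_congr14 {f g : E3 → ℝ} {x : E3} (h : f =ᶠ[nhds x] g) (j : Fin 3) : pd j f x = pd j g x := by
  unfold pd
  rw [h.fderiv_eq]

lemma pd_mul14 {f g : E3 → ℝ} {x : E3} (hf : DifferentiableAt ℝ f x) (hg : DifferentiableAt ℝ g x)
    (j : Fin 3) : pd j (fun z => f z * g z) x = f x * pd j g x + g x * pd j f x := by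
  unfold pd
  rw [fderiv_fun_mul hf hg]
  simp

lemma pd_sum14 {f : Fin 3 → E3 → ℝ} {x : E3} (hf : ∀ i, DifferentiableAt ℝ (f i) x)
    (j : Fin 3) : pd j (fun z => ∑ i, f i z) x = ∑ i, pd j (f i) x := by
  unfold pd
  rw [fderiv_fun_sum (fun i _ => hf i)]
  simp

lemma pd_contDiff14 {f : E3 → ℝ} {x : E3} {m n : WithTop ℕ∞} (hf : ContDiffAt ℝ n f x)
    (hmn : m + 1 ≤ n) (j : Fin 3) : ContDiffAt ℝ m (pd j f) x := by
  unfold pd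
  exact (hf.fderiv_right hmn).clm_apply contDiffAt_const

lemma pd_comm14 {f : E3 → ℝ} {x : E3} (hf : ContDiffAt ℝ 2 f x) (a b : Fin 3) :
    pd a (pd b f) x = pd b (pd a f) x := by
  have hd : DifferentiableAt ℝ (fderiv ℝ f) x :=
    (hf.fderiv_right (m := 1) (by norm_num)).differentiableAt (by norm_num)
  have hs : IsSymmSndFDerivAt ℝ f x := hf.isSymmSndFDerivAt (by simp)
  have key : ∀ a b : Fin 3, pd a (pd b f) x
      = fderiv ℝ (fderiv ℝ f) x (Pi.single a 1) (Pi.single b 1) := by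
    intro a b
    change fderiv ℝ (fun z => fderiv ℝ f z (Pi.single b 1)) x (Pi.single a 1) = _
    rw [fderiv_clm_apply hd (differentiableAt_const _)]
    simp
  rw [key, key]
  exact hs _ _

lemma inv_diff14 {F : E3 → Matrix (Fin 3) (Fin 3) ℝ} {x : E3}
    (hF : ∀ i j, DifferentiableAt ℝ (fun z => F z i j) x) (hu : IsUnit (F x)) (i j : Fin 3) :
    DifferentiableAt ℝ (fun z => (F z)⁻¹ i j) x := by
  have hdet0 : (F x).det ≠ 0 := ((Matrix.isUnit_iff_isUnit_det _).1 hu).ne_zero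
  have hdet : DifferentiableAt ℝ (fun z => (F z).det) x := by
    simp only [Matrix.det_fin_three]
    fun_prop
  have hadj : DifferentiableAt ℝ (fun z => (F z).adjugate i j) x := by
    simp only [Matrix.adjugate_fin_three]
    fin_cases i <;> fin_cases j <;> simp <;> fun_prop
  simp only [Matrix.inv_def, Ring.inverse_eq_inv', Matrix.smul_apply, smul_eq_mul]
  exact (hdet.inv hdet0).mul hadj

/-- The right Cauchy–Green field `C = (Dy)ᵀ Dy` of a C³ map `y` with invertible Jacobian
on an open set `Ω ⊆ ℝ³` has vanishing Riemann–Christoffel curvature on `Ω`. -/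
theorem weingarten_stmt14 (Ω : Set E3) (hΩ : IsOpen Ω)
    (y : E3 → E3) (hy : ContDiffOn ℝ 3 y Ω)
    (hinv : ∀ x ∈ Ω, IsUnit (jac y x))
    (C : E3 → Matrix (Fin 3) (Fin 3) ℝ)
    (hC : ∀ x ∈ Ω, C x = (jac y x)ᵀ * jac y x) :
    ∀ x ∈ Ω, ∀ μ α β ρ : Fin 3,
      pd ρ (christoffel C μ α β) x - pd β (christoffel C μ α ρ) x +
        (∑ γ, (christoffel C μ γ ρ x * christoffel C γ α β x -
               christoffel C μ γ β x * christoffel C γ α ρ x)) = 0 := by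
  have hyc : ∀ x ∈ Ω, ∀ i, ContDiffAt ℝ 3 (fun z => y z i) x := fun x hx i =>
    contDiffAt_pi.1 (hy.contDiffAt (hΩ.mem_nhds hx)) i
  have hF2 : ∀ x ∈ Ω, ∀ i a, ContDiffAt ℝ 2 (pd a (fun z => y z i)) x := fun x hx i a =>
    pd_contDiff14 (hyc x hx i) (by norm_num) a
  have hFd : ∀ x ∈ Ω, ∀ i a, DifferentiableAt ℝ (pd a (fun z => y z i)) x := fun x hx i a =>
    (hF2 x hx i a).differentiableAt (by norm_num)
  have hGd : ∀ x ∈ Ω, ∀ i a b, DifferentiableAt ℝ (pd b (pd a (fun z => y z i))) x :=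
    fun x hx i a b =>
      (pd_contDiff14 (m := 1) (hF2 x hx i a) (by norm_num) b).differentiableAt (by norm_num)
  have hsym : ∀ x ∈ Ω, ∀ i a b, pd b (pd a (fun z => y z i)) x = pd a (pd b (fun z => y z i)) x :=
    fun x hx i a b => pd_comm14 ((hyc x hx i).of_le (by norm_num)) b a
  have hCd : ∀ x ∈ Ω, ∀ a b c, pd c (fun z => C z a b) x =
      ∑ i, (pd a (fun z => y z i) x * pd c (pd b (fun z => y z i)) x
        + pd b (fun z => y z i) x * pd c (pd a (fun z => y z i)) x) := by
    intro x hx a b c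
    have h1 : (fun z => C z a b) =ᶠ[nhds x]
        fun z => ∑ i, pd a (fun z => y z i) z * pd b (fun z => y z i) z := by
      filter_upwards [hΩ.mem_nhds hx] with z hz
      rw [hC z hz]
      simp [Matrix.mul_apply, jac]
    rw [pd_congr14 h1, pd_sum14 (fun i => (hFd x hx i a).fun_mul (hFd x hx i b))]
    exact Finset.sum_congr rfl fun i _ => pd_mul14 (hFd x hx i a) (hFd x hx i b) c
  -- Christoffel symbols in terms of `y`
  have hΓ : ∀ x ∈ Ω, ∀ g a b, christoffel C g a b x =
      ∑ i, (jac y x)⁻¹ g i * pd b (pd a (fun z => y z i)) x := by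
    intro x hx g a b
    have hdet := (Matrix.isUnit_iff_isUnit_det _).1 (hinv x hx)
    have h2 : ∀ m, pd b (fun z => C z a m) x + pd a (fun z => C z b m) x
        - pd m (fun z => C z a b) x
        = 2 * ((jac y x)ᵀ *ᵥ fun i => pd b (pd a (fun z => y z i)) x) m := by
      intro m
      rw [hCd x hx, hCd x hx, hCd x hx, ← Finset.sum_add_distrib, ← Finset.sum_sub_distrib]
      simp only [Matrix.mulVec, dotProduct, Matrix.transpose_apply, jac, Matrix.of_apply]
      rw [Finset.mul_sum]
      refine Finset.sum_congr rfl fun i _ => ?_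
      rw [hsym x hx i b a, hsym x hx i m a, hsym x hx i m b]
      ring
    have h3 : christoffel C g a b x = ((C x)⁻¹ *ᵥ
        ((jac y x)ᵀ *ᵥ fun i => pd b (pd a (fun z => y z i)) x)) g := by
      unfold christoffel
      simp only [h2]
      rw [Matrix.mulVec, dotProduct, Finset.mul_sum]
      exact Finset.sum_congr rfl fun i _ => by ring
    rw [h3, hC x hx, Matrix.mul_inv_rev, Matrix.mulVec_mulVec, Matrix.mul_assoc,
      Matrix.nonsing_inv_mul _ (by rwa [Matrix.det_transpose]), Matrix.mul_one]
    rfl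
  have hΓd : ∀ x ∈ Ω, ∀ g a b, DifferentiableAt ℝ (christoffel C g a b) x := by
    intro x hx g a b
    have h1 : christoffel C g a b =ᶠ[nhds x]
        fun z => ∑ i, (jac y z)⁻¹ g i * pd b (pd a (fun z => y z i)) z := by
      filter_upwards [hΩ.mem_nhds hx] with z hz using hΓ z hz g a b
    refine DifferentiableAt.congr_of_eventuallyEq ?_ h1
    exact DifferentiableAt.fun_sum fun i _ =>
      (inv_diff14 (fun i a => hFd x hx i a) (hinv x hx) g i).mul (hGd x hx i a b)
  have hFΓ : ∀ x ∈ Ω, ∀ i a b, ∑ g, pd g (fun z => y z i) x * christoffel C g a b x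
      = pd b (pd a (fun z => y z i)) x := by
    intro x hx i a b
    have hdet := (Matrix.isUnit_iff_isUnit_det _).1 (hinv x hx)
    have h1 : (fun g => christoffel C g a b x)
        = (jac y x)⁻¹ *ᵥ fun i => pd b (pd a (fun z => y z i)) x := by
      funext g
      rw [hΓ x hx]
      rfl
    change (jac y x *ᵥ fun g => christoffel C g a b x) i = _
    rw [h1, Matrix.mulVec_mulVec, Matrix.mul_nonsing_inv _ hdet, Matrix.one_mulVec]
  -- differentiate the previous identity
  have hD : ∀ x ∈ Ω, ∀ i a b r, ∑ g, (pd g (fun z => y z i) x * pd r (christoffel C g a b) x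
      + christoffel C g a b x * pd r (pd g (fun z => y z i)) x)
      = pd r (pd b (pd a (fun z => y z i))) x := by
    intro x hx i a b r
    have h1 : (fun z => ∑ g, pd g (fun z => y z i) z * christoffel C g a b z) =ᶠ[nhds x]
        pd b (pd a (fun z => y z i)) := by
      filter_upwards [hΩ.mem_nhds hx] with z hz using hFΓ z hz i a b
    rw [← pd_congr14 h1, pd_sum14 (fun g => (hFd x hx i g).fun_mul (hΓd x hx g a b))]
    exact Finset.sum_congr rfl fun g _ => (pd_mul14 (hFd x hx i g) (hΓd x hx g a b) r).symm
  intro x hx μ α β ρ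
  have hdet := (Matrix.isUnit_iff_isUnit_det _).1 (hinv x hx)
  have hR : jac y x *ᵥ (fun μ => pd ρ (christoffel C μ α β) x - pd β (christoffel C μ α ρ) x +
        (∑ γ, (christoffel C μ γ ρ x * christoffel C γ α β x -
               christoffel C μ γ β x * christoffel C γ α ρ x))) = 0 := by
    funext i
    have e1 := hD x hx i α β ρ
    have e2 := hD x hx i α ρ β
    rw [pd_comm14 (hF2 x hx i α) ρ β] at e1
    have e3 := e1.trans e2.symm
    simp only [← hFΓ x hx i] at e3
    simp only [Matrix.mulVec, dotProduct, jac, Matrix.of_apply, Pi.zero_apply]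
    simp only [Fin.sum_univ_three] at e3 ⊢
    linear_combination e3
  have h0 := congrArg (fun v => ((jac y x)⁻¹ *ᵥ v) μ) hR
  simp only [Matrix.mulVec_mulVec, Matrix.nonsing_inv_mul _ hdet, Matrix.one_mulVec,
    Matrix.mulVec_zero, Pi.zero_apply] at h0
  exact h0
end
end

section
/- Let Ω ⊆ ℝ³ be a connected, simply connected open set and let C be a twice continuously differentiable 3×3 matrix field on Ω with C(x) symmetric and positive definite for every x, whose Riemann–Christoffel curvature vanishes: Γ^μ_{αβ,ρ} − Γ^μ_{αρ,β} + Σ_γ (Γ^μ_{γρ} Γ^γ_{αβ} − Γ^μ_{γβ} Γ^γ_{αρ}) = 0 on Ω for all μ,α,β,ρ ∈ {1,2,3}, where Γ are the Christoffel symbols of C. Then there exists a twice continuously differentiable map y : Ω → ℝ³ with det Dy(x) > 0 for all x ∈ Ω and (Dy(x))ᵀ Dy(x) = C(x) for all x ∈ Ω. -/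
noncomputable section

open Matrix

section PfHelpers

open Set Filter Topology Metric

section Pfaff

variable {E : Type*} [NormedAddCommGroup E] [NormedSpace ℝ E]
variable {𝔸 : Type*} [NormedRing 𝔸] [NormedAlgebra ℝ 𝔸] [CompleteSpace 𝔸]

/-- Existence for small linear ODEs on `[0,1]` in a Banach algebra. -/
lemma pf_ode_exists (a : ℝ → 𝔸) (ha : ContinuousOn a (Icc 0 1))
    (hb : ∀ t ∈ Icc (0:ℝ) 1, ‖a t‖ ≤ 1 / 2) :
    ∃ U : ℝ → 𝔸, U 0 = 1 ∧
      ∀ t ∈ Icc (0:ℝ) 1, HasDerivWithinAt U (a t * U t) (Icc 0 1) t := by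
  have hP : IsPicardLindelof (fun t u => a t * u) (tmin := 0) (tmax := 1)
      ⟨0, by simp⟩ (1 : 𝔸) ‖(1 : 𝔸)‖₊ 0 ‖(1 : 𝔸)‖₊ 1 := by
    constructor
    · intro t ht
      apply LipschitzOnWith.of_dist_le_mul
      intro x _ y _
      rw [dist_eq_norm, dist_eq_norm, ← mul_sub]
      refine (norm_mul_le _ _).trans ?_
      have := hb t ht
      have h2 := norm_nonneg (x - y)
      simp only [NNReal.coe_one]
      nlinarith
    · intro x _
      exact ha.mul continuousOn_const
    · intro t ht x hx
      rw [mem_closedBall, dist_eq_norm] at hx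
      have h1 : ‖x‖ ≤ ‖x - 1‖ + ‖(1 : 𝔸)‖ := by
        simpa using norm_add_le (x - 1) 1
      refine (norm_mul_le _ _).trans ?_
      have := hb t ht
      have h2 := norm_nonneg x
      have h3 := norm_nonneg (a t)
      simp only [coe_nnnorm] at hx ⊢
      nlinarith
    · simp
  exact hP.exists_eq_forall_mem_Icc_hasDerivWithinAt₀

/-- Uniform first-order Taylor estimate along a compact set. -/
lemma pf_uniform {F : Type*} [NormedAddCommGroup F] [NormedSpace ℝ F]
    {Ω K : Set E} (hΩ : IsOpen Ω) (hK : IsCompact K) (hKΩ : K ⊆ Ω) {A : E → F}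
    (hA : ContDiffOn ℝ 1 A Ω) {δ : ℝ} (hδ : 0 < δ) :
    ∃ η > 0, ∀ x ∈ K, ∀ k, ‖k‖ < η → ‖A (x + k) - A x‖ ≤ δ ∧
      ‖A (x + k) - A x - fderiv ℝ A x k‖ ≤ δ * ‖k‖ := by
  have hc : ∀ a ∈ K, ContinuousAt A a := fun a ha =>
    hA.continuousOn.continuousAt (hΩ.mem_nhds (hKΩ ha))
  have hc' : ∀ a ∈ K, ContinuousAt (fderiv ℝ A) a := fun a ha =>
    (hA.continuousOn_fderiv_of_isOpen hΩ le_rfl).continuousAt (hΩ.mem_nhds (hKΩ ha))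
  have h1 := hK.uniformContinuousAt_of_continuousAt A hc (dist_mem_uniformity hδ)
  have h2 := hK.uniformContinuousAt_of_continuousAt (fderiv ℝ A) hc' (dist_mem_uniformity hδ)
  obtain ⟨η1, hη1, H1⟩ := Metric.mem_uniformity_dist.1 h1
  obtain ⟨η2, hη2, H2⟩ := Metric.mem_uniformity_dist.1 h2
  obtain ⟨η3, hη3, H3⟩ := hK.exists_thickening_subset_open hΩ hKΩ
  refine ⟨min η1 (min η2 η3), by positivity, fun x hx k hk => ?_⟩
  have hk1 : ‖k‖ < η1 := hk.trans_le (min_le_left _ _)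
  have hk2 : ‖k‖ < η2 := hk.trans_le ((min_le_right _ _).trans (min_le_left _ _))
  have hk3 : ‖k‖ < η3 := hk.trans_le ((min_le_right _ _).trans (min_le_right _ _))
  refine ⟨?_, ?_⟩
  · have : dist (A x) (A (x + k)) < δ := H1 (a := x) (b := x + k) (by simpa) hx
    rw [dist_comm, dist_eq_norm] at this
    exact this.le
  · have := Convex.norm_image_sub_le_of_norm_fderiv_le' (𝕜 := ℝ) (f := A)
      (φ := fderiv ℝ A x) (C := δ) (s := ball x (min η2 η3)) (x := x) (y := x + k) ?_ ?_
      (convex_ball _ _) (by simp; exact ⟨hη2, hη3⟩) (by simp; exact ⟨hk2, hk3⟩)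
    · simpa using this
    · intro y hy
      refine (hA.differentiableOn (by norm_num)).differentiableAt (hΩ.mem_nhds (H3 ?_))
      rw [mem_thickening_iff]
      exact ⟨x, hx, (mem_ball.1 hy).trans_le (min_le_right _ _)⟩
    · intro y hy
      have : dist (fderiv ℝ A x) (fderiv ℝ A y) < δ := H2 (a := x) (b := y)
        (by rw [dist_comm]; exact (mem_ball.1 hy).trans_le (min_le_left _ _)) hx
      rw [dist_comm, dist_eq_norm] at this
      exact this.le

/-- The linear map `h ↦ a h * u`. -/
def pfMul (a : E →L[ℝ] 𝔸) (u : 𝔸) : E →L[ℝ] 𝔸 :=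
  ((ContinuousLinearMap.mul ℝ 𝔸).flip u).comp a

@[simp] lemma pfMul_apply (a : E →L[ℝ] 𝔸) (u : 𝔸) (h : E) : pfMul a u h = a h * u := by
  simp [pfMul]

lemma pf_alg (a b aq Dph Dhp U : 𝔸) (t : ℝ) (hflat : Dph - Dhp + b * a - a * b = 0) :
    (a * U + (t • (Dph * U + b * (a * U)) + b * U)) - aq * (U + t • (b * U)) =
      -(t • ((aq - a) * (b * U)) + (aq - a - b - t • Dhp) * U) := by
  have : Dph = Dhp - b * a + a * b := by
    have := eq_of_sub_eq_zero (a := Dph) (b := Dhp - b * a + a * b) (by rw [← hflat]; abel)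
    exact this
  subst this
  simp only [mul_add, add_mul, sub_mul, smul_add, smul_sub, smul_mul_assoc, mul_smul_comm, mul_assoc]
  abel

/-- Local existence for flat linear Pfaff systems. -/
lemma pf_local {Ω : Set E} (hΩ : IsOpen Ω) (A : E → E →L[ℝ] 𝔸) (hA : ContDiffOn ℝ 1 A Ω)
    (hflat : ∀ x ∈ Ω, ∀ h k : E, fderiv ℝ A x h k - fderiv ℝ A x k h +
      A x k * A x h - A x h * A x k = 0) (x0 : E) (hx0 : x0 ∈ Ω) :
    ∃ r > 0, ball x0 r ⊆ Ω ∧ ∃ Φ : E → 𝔸, Φ x0 = 1 ∧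
      ∀ x ∈ ball x0 r, HasFDerivAt Φ (pfMul (A x) (Φ x)) x := by
  -- choose the radius
  obtain ⟨M, hM0, r, hr, hrΩ, hM, hMr⟩ : ∃ M > 0, ∃ r > 0, ball x0 r ⊆ Ω ∧
      (∀ x ∈ ball x0 r, ‖A x‖ ≤ M) ∧ M * r ≤ 1 / 2 := by
    have hc : ContinuousAt A x0 := hA.continuousOn.continuousAt (hΩ.mem_nhds hx0)
    obtain ⟨r1, hr1, H1⟩ := Metric.continuousAt_iff.1 hc 1 one_pos
    obtain ⟨r2, hr2, H2⟩ := Metric.isOpen_iff.1 hΩ x0 hx0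
    have hMp : 0 < ‖A x0‖ + 1 := by positivity
    refine ⟨‖A x0‖ + 1, hMp, min (min r1 r2) (1 / 2 / (‖A x0‖ + 1)), by positivity, ?_, ?_, ?_⟩
    · exact (ball_subset_ball ((min_le_left _ _).trans (min_le_right _ _))).trans H2
    · intro x hx
      have h1 := H1 ((mem_ball.1 hx).trans_le ((min_le_left _ _).trans (min_le_left _ _)))
      rw [dist_eq_norm] at h1
      have := norm_add_le (A x - A x0) (A x0)
      simp only [sub_add_cancel] at this
      linarith
    · calc _ ≤ (‖A x0‖ + 1) * (1 / 2 / (‖A x0‖ + 1)) := by gcongr; exact min_le_right _ _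
        _ = 1 / 2 := by field_simp
  have hseg : ∀ p : E, ‖p‖ < r → ∀ t ∈ Icc (0:ℝ) 1, x0 + t • p ∈ ball x0 r := by
    intro p hp t ht
    rw [mem_ball, dist_eq_norm, add_sub_cancel_left, norm_smul, Real.norm_of_nonneg ht.1]
    have := norm_nonneg p
    nlinarith [ht.2]
  have hsm : ∀ p : E, ‖p‖ < r → ∀ t ∈ Icc (0:ℝ) 1, ‖A (x0 + t • p) p‖ ≤ 1 / 2 := by
    intro p hp t ht
    refine ((A _).le_opNorm p).trans ?_
    have := hM _ (hseg p hp t ht)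
    calc _ ≤ M * r := by gcongr
      _ ≤ _ := hMr
  have hex : ∀ p : E, ∃ U : ℝ → 𝔸, ‖p‖ < r → (U 0 = 1 ∧
      ∀ t ∈ Icc (0:ℝ) 1, HasDerivWithinAt U (A (x0 + t • p) p * U t) (Icc 0 1) t) := by
    intro p
    by_cases hp : ‖p‖ < r
    · have h1 : ContinuousOn (fun t : ℝ => A (x0 + t • p)) (Icc (0:ℝ) 1) :=
        hA.continuousOn.comp (by fun_prop) fun t ht => hrΩ (hseg p hp t ht)
      obtain ⟨U, hU⟩ := pf_ode_exists (fun t => A (x0 + t • p) p)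
        (h1.clm_apply continuousOn_const) (hsm p hp)
      exact ⟨U, fun _ => hU⟩
    · exact ⟨fun _ => 0, fun h => absurd h hp⟩
  choose U hU using hex
  refine ⟨r, hr, hrΩ, fun x => U (x - x0) 1, ?_, ?_⟩
  · -- value at the centre
    have h0 := hU 0 (by simpa using hr)
    have : ∀ t ∈ Icc (0:ℝ) 1, U 0 t = U 0 0 := by
      apply constant_of_has_deriv_right_zero
      · exact fun t ht => (h0.2 t ht).continuousWithinAt
      · intro t ht
        have := (h0.2 t ⟨ht.1, ht.2.le⟩).mono_of_mem_nhdsWithin (Icc_mem_nhdsGE_of_mem ht)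
        simpa using this
    simp only [sub_self]
    rw [this 1 (by simp), h0.1]
  intro x hx
  obtain ⟨p, rfl⟩ : ∃ p, x = x0 + p := ⟨x - x0, by abel⟩
  have hp : ‖p‖ < r := by simpa using hx
  obtain ⟨hU0, hU'⟩ := hU p hp
  have hUc : ContinuousOn (U p) (Icc 0 1) := fun t ht => (hU' t ht).continuousWithinAt
  obtain ⟨N, hN⟩ := isCompact_Icc.exists_bound_of_continuousOn hUc
  have hN0 : 0 ≤ N := (norm_nonneg _).trans (hN 0 (by simp))
  rw [hasFDerivAt_iff_isLittleO_nhds_zero, Asymptotics.isLittleO_iff]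
  intro ε hε
  obtain ⟨K1, hK1⟩ : ∃ K1, K1 = (r * M + M * M + 1 + r) * N + 1 := ⟨_, rfl⟩
  have hK1p : 0 < K1 := by rw [hK1]; positivity
  obtain ⟨δ, hδ⟩ : ∃ δ, δ = ε / (2 * K1) := ⟨_, rfl⟩
  have hδp : 0 < δ := by rw [hδ]; positivity
  have hKc : IsCompact ((fun t : ℝ => x0 + t • p) '' Icc 0 1) :=
    isCompact_Icc.image (by fun_prop)
  obtain ⟨η, hη, H⟩ := pf_uniform hΩ hKc
    (by rintro _ ⟨t, ht, rfl⟩; exact hrΩ (hseg p hp t ht)) hA hδp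
  have hnear : ∀ᶠ h in 𝓝 (0:E), ‖h‖ < min (min η δ) (r - ‖p‖) := by
    have : 0 < min (min η δ) (r - ‖p‖) := by
      simp only [lt_min_iff]; exact ⟨⟨hη, hδp⟩, by linarith⟩
    filter_upwards [ball_mem_nhds (0:E) this] with h hh
    simpa using hh
  filter_upwards [hnear] with h hh
  have hh1 : ‖h‖ < η := hh.trans_le ((min_le_left _ _).trans (min_le_left _ _))
  have hh2 : ‖h‖ < δ := hh.trans_le ((min_le_left _ _).trans (min_le_right _ _))
  have hh3 : ‖h‖ < r - ‖p‖ := hh.trans_le (min_le_right _ _)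
  have hq : ‖p + h‖ < r := (norm_add_le _ _).trans_lt (by linarith)
  obtain ⟨hV0, hV'⟩ := hU (p + h) hq
  have hVc : ContinuousOn (U (p + h)) (Icc 0 1) := fun t ht => (hV' t ht).continuousWithinAt
  -- comparison curve
  have hc' : ∀ t ∈ Icc (0:ℝ) 1, HasDerivWithinAt
      (fun t => U p t + t • (A (x0 + t • p) h * U p t))
      (A (x0 + t • p) p * U p t + (t • (fderiv ℝ A (x0 + t • p) p h * U p t +
        A (x0 + t • p) h * (A (x0 + t • p) p * U p t)) + A (x0 + t • p) h * U p t))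
      (Icc 0 1) t := by
    intro t ht
    have hd : DifferentiableAt ℝ A (x0 + t • p) :=
      (hA.differentiableOn (by norm_num)).differentiableAt (hΩ.mem_nhds (hrΩ (hseg p hp t ht)))
    have hl : HasDerivAt (fun t : ℝ => x0 + t • p) p t := by
      simpa using ((hasDerivAt_id t).smul_const p).const_add x0
    have hAd : HasDerivAt (fun t : ℝ => A (x0 + t • p)) (fderiv ℝ A (x0 + t • p) p) t :=
      hd.hasFDerivAt.comp_hasDerivAt t hl
    have hAh : HasDerivAt (fun t : ℝ => A (x0 + t • p) h) (fderiv ℝ A (x0 + t • p) p h) t := by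
      simpa using hAd.clm_apply (hasDerivAt_const t h)
    have hm := hAh.hasDerivWithinAt.mul (hU' t ht)
    have := (hU' t ht).add ((hasDerivAt_id t).hasDerivWithinAt.smul hm)
    simpa using! this
  set c : ℝ → 𝔸 := fun t => U p t + t • (A (x0 + t • p) h * U p t) with hcdef
  have hg := norm_le_gronwallBound_of_norm_deriv_right_le
    (f := fun t => c t - U (p + h) t) (δ := 0) (K := 1) (ε := δ * (K1 * ‖h‖)) (a := 0) (b := 1)
    (f' := fun t => (A (x0 + t • p) p * U p t + (t • (fderiv ℝ A (x0 + t • p) p h * U p t +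
        A (x0 + t • p) h * (A (x0 + t • p) p * U p t)) + A (x0 + t • p) h * U p t)) -
        A (x0 + t • (p + h)) (p + h) * U (p + h) t)
    ((show ContinuousOn c (Icc 0 1) from fun t ht => (hc' t ht).continuousWithinAt).sub hVc)
    (fun t ht => ((hc' t ⟨ht.1, ht.2.le⟩).sub (hV' t ⟨ht.1, ht.2.le⟩)).mono_of_mem_nhdsWithin
      (Icc_mem_nhdsGE_of_mem ht)) (by simp [hcdef, hU0, hV0]) ?_ 1 (by simp)
  · rw [gronwallBound_of_K_ne_0 one_ne_zero] at hg
    have he : Real.exp 1 ≤ 3 := by linarith [Real.exp_one_lt_d9]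
    have e1 : U (x0 + p + h - x0) 1 - U (x0 + p - x0) 1 -
        (pfMul (A (x0 + p)) (U (x0 + p - x0) 1)) h = -(c 1 - U (p + h) 1) := by
      have : x0 + p + h - x0 = p + h := by abel
      rw [this]
      simp only [add_sub_cancel_left, pfMul_apply, hcdef, one_smul]
      abel
    rw [e1, norm_neg]
    refine hg.trans ?_
    simp only [sub_zero, zero_mul, zero_add, div_one, one_mul]
    calc δ * (K1 * ‖h‖) * (Real.exp 1 - 1) ≤ δ * (K1 * ‖h‖) * 2 := by gcongr; linarith
      _ = ε * ‖h‖ := by rw [hδ]; field_simp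
  · intro t ht'
    have ht : t ∈ Icc (0:ℝ) 1 := ⟨ht'.1, ht'.2.le⟩
    set Ap := A (x0 + t • p) with hAp
    set Aq := A (x0 + t • (p + h)) with hAq
    have hMp : ‖Ap‖ ≤ M := hM _ (hseg p hp t ht)
    have hth : ‖t • h‖ ≤ ‖h‖ := by
      rw [norm_smul, Real.norm_of_nonneg ht.1]
      nlinarith [ht.2, norm_nonneg h]
    obtain ⟨H1, H2⟩ := H (x0 + t • p) ⟨t, ht, rfl⟩ (t • h) (hth.trans_lt hh1)
    have e2 : x0 + t • p + t • h = x0 + t • (p + h) := by rw [smul_add, add_assoc]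
    rw [e2, ← hAp, ← hAq] at H1 H2
    have H2' : ‖Aq - Ap - t • fderiv ℝ A (x0 + t • p) h‖ ≤ δ * ‖h‖ := by
      rw [map_smul] at H2
      exact H2.trans (by gcongr)
    have key := pf_alg (Ap p) (Ap h) (Aq (p + h)) (fderiv ℝ A (x0 + t • p) p h)
      (fderiv ℝ A (x0 + t • p) h p) (U p t) t (hflat _ (hrΩ (hseg p hp t ht)) p h)
    have e3 : ∀ X : 𝔸, X - Aq (p + h) * U (p + h) t =
        (X - Aq (p + h) * (U p t + t • (Ap h * U p t))) +
          Aq (p + h) * (c t - U (p + h) t) := by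
      intro X
      simp only [hcdef, mul_sub]; abel
    rw [e3, key]
    have b1 : ‖Aq (p + h) * (c t - U (p + h) t)‖ ≤ 1 * ‖c t - U (p + h) t‖ := by
      refine (norm_mul_le _ _).trans ?_
      gcongr
      exact (hsm _ hq t ht).trans (by norm_num)
    have e4 : Aq (p + h) - Ap p = (Aq - Ap) (p + h) + Ap h := by
      simp; abel
    have b2 : ‖Aq (p + h) - Ap p‖ ≤ δ * r + M * δ := by
      rw [e4]
      refine (norm_add_le _ _).trans (add_le_add ?_ ?_)
      · exact ((Aq - Ap).le_opNorm _).trans (by gcongr)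
      · exact (Ap.le_opNorm _).trans (by gcongr)
    have e5 : Aq (p + h) - Ap p - Ap h - t • fderiv ℝ A (x0 + t • p) h p =
        (Aq - Ap) h + (Aq - Ap - t • fderiv ℝ A (x0 + t • p) h) p := by
      simp; abel
    have b3 : ‖Aq (p + h) - Ap p - Ap h - t • fderiv ℝ A (x0 + t • p) h p‖ ≤
        δ * ‖h‖ + δ * ‖h‖ * r := by
      rw [e5]
      refine (norm_add_le _ _).trans (add_le_add ?_ ?_)
      · exact ((Aq - Ap).le_opNorm _).trans (by gcongr)
      · exact (ContinuousLinearMap.le_opNorm _ _).trans (by gcongr)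
    have b4 : ‖Ap h * U p t‖ ≤ M * ‖h‖ * N := by
      refine (norm_mul_le _ _).trans ?_
      gcongr
      · exact (Ap.le_opNorm _).trans (by gcongr)
      · exact hN t ht
    have b5 : ‖t • ((Aq (p + h) - Ap p) * (Ap h * U p t))‖ ≤ (δ * r + M * δ) * (M * ‖h‖ * N) := by
      rw [norm_smul, Real.norm_of_nonneg ht.1]
      calc _ ≤ 1 * ‖(Aq (p + h) - Ap p) * (Ap h * U p t)‖ := by gcongr; exact ht.2
        _ ≤ _ := by
          rw [one_mul]
          refine (norm_mul_le _ _).trans ?_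
          gcongr
    have b6 : ‖(Aq (p + h) - Ap p - Ap h - t • fderiv ℝ A (x0 + t • p) h p) * U p t‖ ≤
        (δ * ‖h‖ + δ * ‖h‖ * r) * N := by
      refine (norm_mul_le _ _).trans ?_
      gcongr
      exact hN t ht
    refine (norm_add_le _ _).trans ?_
    rw [norm_neg, add_comm]
    refine add_le_add b1 ((norm_add_le _ _).trans ((add_le_add b5 b6).trans ?_))
    have : δ * (K1 * ‖h‖) = (δ * r + M * δ) * (M * ‖h‖ * N) +
        (δ * ‖h‖ + δ * ‖h‖ * r) * N + δ * ‖h‖ := by rw [hK1]; ring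
    rw [this]
    have := mul_nonneg hδp.le (norm_nonneg h)
    linarith

end Pfaff

section PfaffGlobal

variable {E : Type*} [NormedAddCommGroup E] [NormedSpace ℝ E]

/-- Uniqueness for functions whose derivative is controlled by their value. -/
lemma pf_unique {F : Type*} [NormedAddCommGroup F] [NormedSpace ℝ F] {Ω : Set E}
    (hΩ : IsOpen Ω) (hconn : IsPreconnected Ω) (u : E → F) (u' : E → E →L[ℝ] F) (K : E → ℝ)
    (hK : ContinuousOn K Ω) (hu : ∀ x ∈ Ω, HasFDerivAt u (u' x) x)
    (hb : ∀ x ∈ Ω, ‖u' x‖ ≤ K x * ‖u x‖) {x0 : E} (hx0 : x0 ∈ Ω) (h0 : u x0 = 0) :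
    ∀ x ∈ Ω, u x = 0 := by
  have hloc : ∀ a ∈ Ω, u a = 0 → ∀ᶠ x in 𝓝 a, u x = 0 := by
    intro a ha hua
    obtain ⟨r1, hr1, H1⟩ := Metric.continuousAt_iff.1
      (hK.continuousAt (hΩ.mem_nhds ha)) 1 one_pos
    obtain ⟨r2, hr2, H2⟩ := Metric.isOpen_iff.1 hΩ a ha
    filter_upwards [ball_mem_nhds a (lt_min hr1 hr2)] with x hx
    have hseg : ∀ t ∈ Icc (0:ℝ) 1, a + t • (x - a) ∈ ball a (min r1 r2) := by
      intro t ht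
      rw [mem_ball, dist_eq_norm] at hx
      rw [mem_ball, dist_eq_norm, add_sub_cancel_left, norm_smul, Real.norm_of_nonneg ht.1]
      have := norm_nonneg (x - a)
      nlinarith [ht.2]
    have hsΩ : ∀ t ∈ Icc (0:ℝ) 1, a + t • (x - a) ∈ Ω := fun t ht =>
      H2 (ball_subset_ball (min_le_right _ _) (hseg t ht))
    have hder : ∀ t ∈ Icc (0:ℝ) 1, HasDerivAt (fun t : ℝ => u (a + t • (x - a)))
        (u' (a + t • (x - a)) (x - a)) t := by
      intro t ht
      have hl : HasDerivAt (fun t : ℝ => a + t • (x - a)) (x - a) t := by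
        simpa using ((hasDerivAt_id t).smul_const (x - a)).const_add a
      exact (hu _ (hsΩ t ht)).comp_hasDerivAt t hl
    have := eq_zero_of_abs_deriv_le_mul_abs_self_of_eq_zero_right
      (f := fun t : ℝ => u (a + t • (x - a))) (K := (K a + 1) * ‖x - a‖) (a := 0) (b := 1)
      (f' := fun t => u' (a + t • (x - a)) (x - a))
      (fun t ht => (hder t ht).continuousAt.continuousWithinAt)
      (fun t ht => (hder t ⟨ht.1, ht.2.le⟩).hasDerivWithinAt) (by simp [hua]) ?_ 1 (by simp)
    · simpa using this
    · intro t ht'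
      have ht : t ∈ Icc (0:ℝ) 1 := ⟨ht'.1, ht'.2.le⟩
      refine (ContinuousLinearMap.le_opNorm _ _).trans ?_
      have h1 := hb _ (hsΩ t ht)
      have h2 : K (a + t • (x - a)) ≤ K a + 1 := by
        have := H1 (mem_ball.1 (ball_subset_ball (min_le_left _ _) (hseg t ht)))
        rw [Real.dist_eq] at this
        linarith [(abs_lt.1 this).2]
      calc _ ≤ (K (a + t • (x - a)) * ‖u (a + t • (x - a))‖) * ‖x - a‖ := by gcongr
        _ ≤ ((K a + 1) * ‖u (a + t • (x - a))‖) * ‖x - a‖ := by gcongr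
        _ = _ := by ring
  have hopen1 : IsOpen {x | x ∈ Ω ∧ u x = 0} := by
    rw [isOpen_iff_mem_nhds]
    rintro a ⟨ha, hua⟩
    filter_upwards [hloc a ha hua, hΩ.mem_nhds ha] with x h1 h2 using ⟨h2, h1⟩
  have hopen2 : IsOpen {x | x ∈ Ω ∧ u x ≠ 0} := by
    rw [isOpen_iff_mem_nhds]
    rintro a ⟨ha, hua⟩
    filter_upwards [(hu a ha).continuousAt.eventually_ne hua, hΩ.mem_nhds ha] with x h1 h2
      using ⟨h2, h1⟩
  have := hconn.subset_left_of_subset_union hopen1 hopen2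
    (Set.disjoint_left.2 fun x h1 h2 => h2.2 h1.2)
    (fun x hx => (em (u x = 0)).elim (fun h => Or.inl ⟨hx, h⟩) (fun h => Or.inr ⟨hx, h⟩))
    ⟨x0, hx0, hx0, h0⟩
  exact fun x hx => (this hx).2

variable {𝔸 : Type*} [NormedRing 𝔸] [NormedAlgebra ℝ 𝔸] [CompleteSpace 𝔸]

/-- A copy of `𝔸` with the discrete topology. -/
def PfDisc (𝔸 : Type*) : Type _ := 𝔸

instance (𝔸 : Type*) : TopologicalSpace (PfDisc 𝔸) := ⊥
instance (𝔸 : Type*) : DiscreteTopology (PfDisc 𝔸) := ⟨rfl⟩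

lemma pf_overlap {s : Set E} (hs : IsOpen s) (hc : IsPreconnected s) (A : E → E →L[ℝ] 𝔸)
    (hA : ContinuousOn A s) (Φ Ψ : E → 𝔸)
    (hΦ : ∀ x ∈ s, HasFDerivAt Φ (pfMul (A x) (Φ x)) x)
    (hΨ : ∀ x ∈ s, HasFDerivAt Ψ (pfMul (A x) (Ψ x)) x)
    (hu : ∀ x ∈ s, IsUnit (Ψ x)) {x y : E} (hx : x ∈ s) (hy : y ∈ s) :
    Ring.inverse (Ψ y) * Φ y = Ring.inverse (Ψ x) * Φ x := by
  set m := Ring.inverse (Ψ x) * Φ x with hm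
  have := pf_unique hs hc (fun z => Φ z - Ψ z * m)
    (fun z => pfMul (A z) (Φ z - Ψ z * m)) (fun z => ‖A z‖) hA.norm ?_ ?_ hx ?_ y hy
  · have h : Φ y = Ψ y * m := sub_eq_zero.1 this
    rw [h, ← mul_assoc, Ring.inverse_mul_cancel _ (hu y hy), one_mul]
  · intro z hz
    have := (hΦ z hz).sub ((hΨ z hz).mul_const' m)
    refine HasFDerivAt.congr_fderiv (f := fun z => Φ z - Ψ z * m) this ?_
    ext h
    simp [mul_sub, mul_assoc]
  · intro z hz
    refine ContinuousLinearMap.opNorm_le_bound _ (by positivity) fun h => ?_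
    rw [pfMul_apply]
    refine (norm_mul_le _ _).trans ?_
    calc _ ≤ (‖A z‖ * ‖h‖) * ‖Φ z - Ψ z * m‖ := by gcongr; exact (A z).le_opNorm h
      _ = _ := by ring
  · simp only [hm]
    rw [← mul_assoc, Ring.mul_inverse_cancel _ (hu x hx), one_mul, sub_self]

/-- Global existence for flat linear Pfaff systems on simply connected open sets. -/
theorem pf_global {Ω : Set E} (hΩ : IsOpen Ω) (hsc : SimplyConnectedSpace Ω)
    (A : E → E →L[ℝ] 𝔸) (hA : ContDiffOn ℝ 1 A Ω)
    (hflat : ∀ x ∈ Ω, ∀ h k : E, fderiv ℝ A x h k - fderiv ℝ A x k h +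
      A x k * A x h - A x h * A x k = 0) (x0 : E) (hx0 : x0 ∈ Ω) :
    ∃ Φ : E → 𝔸, Φ x0 = 1 ∧ ∀ x ∈ Ω, HasFDerivAt Φ (pfMul (A x) (Φ x)) x := by
  have hloc : ∀ i : Ω, ∃ r > 0, ball (i : E) r ⊆ Ω ∧ ∃ Φ : E → 𝔸, Φ i = 1 ∧
      ∀ x ∈ ball (i : E) r, IsUnit (Φ x) ∧ HasFDerivAt Φ (pfMul (A x) (Φ x)) x := by
    intro i
    obtain ⟨r, hr, hrΩ, Φ, h1, h2⟩ := pf_local hΩ A hA hflat i i.2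
    have hc : ContinuousAt Φ i := (h2 i (mem_ball_self hr)).continuousAt
    have hev : ∀ᶠ x in 𝓝 (i : E), IsUnit (Φ x) := by
      refine hc.eventually (Units.isOpen.mem_nhds ?_)
      rw [h1]; exact isUnit_one
    obtain ⟨r', hr', H⟩ := Metric.eventually_nhds_iff_ball.1 hev
    refine ⟨min r r', lt_min hr hr', (ball_subset_ball (min_le_left _ _)).trans hrΩ, Φ, h1, ?_⟩
    intro x hx
    exact ⟨H x (ball_subset_ball (min_le_right _ _) hx),
      h2 x (ball_subset_ball (min_le_left _ _) hx)⟩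
  choose r hr hrΩ Φ h1 h2 using hloc
  let bs : Ω → Set Ω := fun i => {x : Ω | (x : E) ∈ ball (i : E) (r i)}
  have hbs : ∀ i, IsOpen (bs i) := fun i => isOpen_ball.preimage continuous_subtype_val
  have hover : ∀ i j : Ω, ∀ x ∈ bs i ∩ bs j, ∀ y ∈ bs i ∩ bs j,
      Ring.inverse (Φ j y) * Φ i y = Ring.inverse (Φ j x) * Φ i x := by
    intro i j x hx y hy
    exact pf_overlap (s := ball (i : E) (r i) ∩ ball (j : E) (r j))
      (isOpen_ball.inter isOpen_ball)
      ((convex_ball _ _).inter (convex_ball _ _)).isPreconnected A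
      (hA.continuousOn.mono (inter_subset_left.trans (hrΩ i))) (Φ i) (Φ j)
      (fun z hz => (h2 i z hz.1).2) (fun z hz => (h2 j z hz.2).2)
      (fun z hz => (h2 j z hz.2).1) hx hy
  let Z : FiberBundleCore Ω Ω (PfDisc 𝔸) :=
    { baseSet := bs
      isOpen_baseSet := hbs
      indexAt := id
      mem_baseSet_at := fun x => mem_ball_self (hr x)
      coordChange := fun i j x v => (Ring.inverse (Φ j x) * Φ i x * (show 𝔸 from v) : 𝔸)
      coordChange_self := by
        intro i x hx v
        rw [Ring.inverse_mul_cancel _ (h2 i x hx).1]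
        exact one_mul (M := 𝔸) v
      continuousOn_coordChange := by
        intro i j p hp
        apply ContinuousAt.continuousWithinAt
        have hev : (fun _ => (Ring.inverse (Φ j p.1) * Φ i p.1 * (show 𝔸 from p.2) : 𝔸)) =ᶠ[𝓝 p]
            (fun p : Ω × PfDisc 𝔸 =>
              (Ring.inverse (Φ j p.1) * Φ i p.1 * (show 𝔸 from p.2) : 𝔸)) := by
          have hn : (bs i ∩ bs j) ×ˢ ({p.2} : Set (PfDisc 𝔸)) ∈ 𝓝 p :=
            (((hbs i).inter (hbs j)).prod (isOpen_discrete _)).mem_nhds ⟨hp.1, rfl⟩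
          filter_upwards [hn] with q hq
          have e : q.2 = p.2 := hq.2
          rw [e, hover i j p.1 hp.1 q.1 hq.1]
        exact ContinuousAt.congr (f := fun _ => (show PfDisc 𝔸 from
          (Ring.inverse (Φ j p.1) * Φ i p.1 * (show 𝔸 from p.2) : 𝔸))) continuousAt_const hev
      coordChange_comp := by
        intro i j k x hx v
        change Ring.inverse (Φ k x) * Φ j x * (Ring.inverse (Φ j x) * Φ i x * (show 𝔸 from v)) =
          Ring.inverse (Φ k x) * Φ i x * (show 𝔸 from v)
        have := Ring.mul_inverse_cancel _ (h2 j x hx.1.2).1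
        rw [mul_assoc, mul_assoc (Ring.inverse (Φ j x)), ← mul_assoc (Φ j x), this, one_mul,
          mul_assoc] }
  have hcov : IsCoveringMap (Bundle.TotalSpace.proj : Z.TotalSpace → Ω) :=
    FiberBundle.isCoveringMap
  have : LocallyPathConnectedSpace Ω := hΩ.locallyPathConnectedSpace
  obtain ⟨s, ⟨hs0, hs⟩, -⟩ := hcov.existsUnique_continuousMap_lifts
    (ContinuousMap.id Ω) ⟨x0, hx0⟩ (⟨⟨x0, hx0⟩, (show 𝔸 from 1)⟩ : Z.TotalSpace) rfl
  have hsp : ∀ x : Ω, (s x).1 = x := fun x => congrFun hs x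
  obtain ⟨sv, hsv⟩ : ∃ sv : Ω → 𝔸, ∀ x, sv x = (s x).2 := ⟨_, fun _ => rfl⟩
  classical
  let u : E → 𝔸 := fun x => if hx : x ∈ Ω then sv ⟨x, hx⟩ else 0
  refine ⟨u, ?_, ?_⟩
  · simp only [u, dif_pos hx0]
    rw [hsv, hs0]
  intro x hx
  let i : Ω := ⟨x, hx⟩
  have hcont : ContinuousAt (fun y : Ω => ((Z.localTriv i) (s y)).2) i := by
    have : ContinuousAt (fun y : Ω => (Z.localTriv i) (s y)) i := by
      refine ContinuousAt.comp (f := s) (g := Z.localTriv i) ?_ s.continuous.continuousAt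
      apply (Z.localTriv i).continuousAt
      rw [FiberBundleCore.mem_localTriv_source, hsp]
      exact mem_ball_self (hr i)
    exact this.snd
  have hev : ∀ᶠ y in 𝓝 i, ((Z.localTriv i) (s y)).2 = ((Z.localTriv i) (s i)).2 :=
    hcont.eventually ((isOpen_discrete {((Z.localTriv i) (s i)).2}).mem_nhds rfl)
  obtain ⟨w, hw⟩ : ∃ w : 𝔸, w = ((Z.localTriv i) (s i)).2 := ⟨_, rfl⟩
  have hval : ∀ y : Ω, ((Z.localTriv i) (s y)).2 =
      (Ring.inverse (Φ i y) * sv y : 𝔸) := by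
    intro y
    rw [hsv]
    change Ring.inverse (Φ i ((s y).1 : Ω)) * Φ (s y).1 ((s y).1 : Ω) * (show 𝔸 from (s y).2) = _
    rw [h1, mul_one, hsp]
  have hloc' : u =ᶠ[𝓝 x] fun y => Φ i y * w := by
    have h3 : ∀ᶠ y in 𝓝 x, ∃ hy : y ∈ Ω, ((Z.localTriv i) (s ⟨y, hy⟩)).2 = w := by
      rw [nhds_subtype_eq_comap, eventually_comap] at hev
      filter_upwards [hev, hΩ.mem_nhds hx] with y hy1 hy2
      exact ⟨hy2, (hy1 ⟨y, hy2⟩ rfl).trans hw.symm⟩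
    filter_upwards [h3, ball_mem_nhds x (hr i)] with y ⟨hy, h4⟩ hy2
    rw [hval] at h4
    simp only [u, dif_pos hy]
    rw [← h4, ← mul_assoc, Ring.mul_inverse_cancel _ (h2 i y hy2).1, one_mul]
  have hd := ((h2 i x (mem_ball_self (hr i))).2.mul_const' w).congr_of_eventuallyEq hloc'
  refine hd.congr_fderiv ?_
  ext h
  rw [hloc'.eq_of_nhds]
  simp [mul_assoc]

end PfaffGlobal

section Frame

/-- State space of the linear system: a covector together with a scalar. -/
abbrev PfV : Type := E3 × ℝ

/-- Elementary maps. -/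
def pfT (α γ : Fin 3) : PfV →L[ℝ] PfV :=
  ((ContinuousLinearMap.proj (R := ℝ) (φ := fun _ : Fin 3 => ℝ) γ).comp
    (ContinuousLinearMap.fst ℝ E3 ℝ)).smulRight ((Pi.single α 1, 0) : PfV)

/-- Elementary maps, scalar part. -/
def pfS (β : Fin 3) : PfV →L[ℝ] PfV :=
  ((ContinuousLinearMap.proj (R := ℝ) (φ := fun _ : Fin 3 => ℝ) β).comp
    (ContinuousLinearMap.fst ℝ E3 ℝ)).smulRight ((0, 1) : PfV)

/-- Coordinate projection. -/
abbrev pfp (β : Fin 3) : E3 →L[ℝ] ℝ :=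
  ContinuousLinearMap.proj (R := ℝ) (φ := fun _ : Fin 3 => ℝ) β

/-- The connection form of the system. -/
def pfA (G : Fin 3 → Fin 3 → Fin 3 → E3 → ℝ) (x : E3) : E3 →L[ℝ] (PfV →L[ℝ] PfV) :=
  (∑ β, (pfp β).smulRight (pfS β)) +
    ∑ α, ∑ β, ∑ γ, G γ α β x • (pfp β).smulRight (pfT α γ)

lemma pfA_apply (G : Fin 3 → Fin 3 → Fin 3 → E3 → ℝ) (x k : E3) (v : PfV) :
    pfA G x k v = (fun α => ∑ β, ∑ γ, G γ α β x * k β * v.1 γ, ∑ β, k β * v.1 β) := by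
  ext α
  · simp [pfA, pfT, pfS, ContinuousLinearMap.sum_apply, Prod.fst_sum, Finset.sum_apply,
      Pi.single_apply, Finset.sum_ite_eq, mul_assoc]
  · simp [pfA, pfT, pfS, ContinuousLinearMap.sum_apply, Prod.snd_sum]

lemma pf_smulc {W : Type*} [NormedAddCommGroup W] [NormedSpace ℝ W] {Ω : Set E3} {c : E3 → ℝ}
    (hc : ContDiffOn ℝ 1 c Ω) (w : W) : ContDiffOn ℝ 1 (fun x => c x • w) Ω :=
  hc.smul contDiffOn_const

lemma pf_smuld {W : Type*} [NormedAddCommGroup W] [NormedSpace ℝ W] {x : E3} {c : E3 → ℝ}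
    {c' : E3 →L[ℝ] ℝ} (hc : HasFDerivAt c c' x) (w : W) :
    HasFDerivAt (fun x => c x • w) (c'.smulRight w) x :=
  hc.smul_const w

lemma pf_sumd {W : Type*} [NormedAddCommGroup W] [NormedSpace ℝ W] {x : E3}
    {c : Fin 3 → E3 → W} {c' : Fin 3 → E3 →L[ℝ] W} (hc : ∀ i, HasFDerivAt (c i) (c' i) x) :
    HasFDerivAt (fun x => ∑ i, c i x) (∑ i, c' i) x :=
  HasFDerivAt.fun_sum fun i _ => hc i

lemma pf_addd {W : Type*} [NormedAddCommGroup W] [NormedSpace ℝ W] {x : E3}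
    {c : E3 → W} {c' : E3 →L[ℝ] W} (w : W) (hc : HasFDerivAt c c' x) :
    HasFDerivAt (fun x => w + c x) c' x :=
  hc.const_add w

lemma pfA_contDiffOn {Ω : Set E3} (G : Fin 3 → Fin 3 → Fin 3 → E3 → ℝ)
    (hG : ∀ γ α β, ContDiffOn ℝ 1 (G γ α β) Ω) : ContDiffOn ℝ 1 (pfA G) Ω := by
  unfold pfA
  refine contDiffOn_const.add ?_
  refine ContDiffOn.sum fun α _ => ContDiffOn.sum fun β _ => ContDiffOn.sum fun γ _ => ?_
  exact pf_smulc (hG γ α β) _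

lemma pfA_fderiv {Ω : Set E3} (hΩ : IsOpen Ω) (G : Fin 3 → Fin 3 → Fin 3 → E3 → ℝ)
    (hG : ∀ γ α β, ContDiffOn ℝ 1 (G γ α β) Ω) (x : E3) (hx : x ∈ Ω) (h k : E3) (v : PfV) :
    fderiv ℝ (pfA G) x h k v =
      (fun α => ∑ β, ∑ γ, fderiv ℝ (G γ α β) x h * k β * v.1 γ, 0) := by
  have hd : HasFDerivAt (pfA G) (∑ α, ∑ β, ∑ γ,
      (fderiv ℝ (G γ α β) x).smulRight ((pfp β).smulRight (pfT α γ))) x := by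
    unfold pfA
    refine pf_addd (W := E3 →L[ℝ] PfV →L[ℝ] PfV) _ ?_
    refine pf_sumd (W := E3 →L[ℝ] PfV →L[ℝ] PfV) fun α => ?_
    refine pf_sumd (W := E3 →L[ℝ] PfV →L[ℝ] PfV) fun β => ?_
    refine pf_sumd (W := E3 →L[ℝ] PfV →L[ℝ] PfV) fun γ => ?_
    have h1 := (((hG γ α β).differentiableOn (by norm_num)).differentiableAt
      (hΩ.mem_nhds hx)).hasFDerivAt
    exact pf_smuld (W := E3 →L[ℝ] PfV →L[ℝ] PfV) h1 _
  rw [hd.fderiv]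
  ext α
  · simp [pfT, ContinuousLinearMap.sum_apply, Prod.fst_sum, Finset.sum_apply,
      Pi.single_apply, mul_assoc]
  · simp [pfT, ContinuousLinearMap.sum_apply, Prod.snd_sum]

lemma pfA_flat {Ω : Set E3} (hΩ : IsOpen Ω) (G : Fin 3 → Fin 3 → Fin 3 → E3 → ℝ)
    (hG : ∀ γ α β, ContDiffOn ℝ 1 (G γ α β) Ω)
    (hsymm : ∀ x ∈ Ω, ∀ γ α β, G γ α β x = G γ β α x)
    (hcurv : ∀ x ∈ Ω, ∀ μ α β ρ : Fin 3,
      pd ρ (G μ α β) x - pd β (G μ α ρ) x +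
        (∑ γ, (G μ γ ρ x * G γ α β x - G μ γ β x * G γ α ρ x)) = 0) :
    ∀ x ∈ Ω, ∀ h k : E3, fderiv ℝ (pfA G) x h k - fderiv ℝ (pfA G) x k h +
      pfA G x k * pfA G x h - pfA G x h * pfA G x k = 0 := by
  intro x hx h k
  let B : E3 →ₗ[ℝ] E3 →ₗ[ℝ] (PfV →L[ℝ] PfV) := LinearMap.mk₂ ℝ
    (fun h k => fderiv ℝ (pfA G) x h k - fderiv ℝ (pfA G) x k h +
      pfA G x k * pfA G x h - pfA G x h * pfA G x k)
    (by intro a b c; simp [mul_add, add_mul]; abel)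
    (by intro a b c; simp [smul_sub, smul_add])
    (by intro a b c; simp [mul_add, add_mul]; abel)
    (by intro a b c; simp [smul_sub, smul_add])
  have hB : B = 0 := by
    refine LinearMap.ext_basis (Pi.basisFun ℝ (Fin 3)) (Pi.basisFun ℝ (Fin 3)) fun ρ β => ?_
    simp only [Pi.basisFun_apply, B, LinearMap.mk₂_apply, LinearMap.zero_apply]
    refine ContinuousLinearMap.ext fun v => ?_
    simp only [ContinuousLinearMap.add_apply, ContinuousLinearMap.sub_apply,
      ContinuousLinearMap.mul_apply, pfA_apply, pfA_fderiv hΩ G hG x hx,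
      ContinuousLinearMap.zero_apply]
    ext α
    · have h0 := hcurv x hx 0 α β ρ
      have h1 := hcurv x hx 1 α β ρ
      have h2 := hcurv x hx 2 α β ρ
      simp only [pd] at h0 h1 h2
      simp only [Pi.single_apply, Prod.fst_add, Prod.fst_sub, Pi.add_apply, Pi.sub_apply,
        mul_ite, ite_mul, mul_one, mul_zero, zero_mul, Prod.fst_zero, Pi.zero_apply]
      have hs : ∀ (j : Fin 3) (F : Fin 3 → Fin 3 → ℝ),
          (∑ b, ∑ g, if b = j then F b g else 0) = ∑ g, F j g := by
        intro j F
        rw [Finset.sum_comm]; simp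
      simp only [hs]
      simp only [Fin.sum_univ_three] at h0 h1 h2 ⊢
      linear_combination v.1 0 * h0 + v.1 1 * h1 + v.1 2 * h2
    · simp [Pi.single_apply, Finset.sum_ite_eq]
      have hs : ∀ (j : Fin 3) (F : Fin 3 → Fin 3 → ℝ),
          (∑ b, ∑ g, if b = j then F b g else 0) = ∑ g, F j g := by
        intro j F
        rw [Finset.sum_comm]; simp
      simp only [hs, hsymm x hx _ β ρ]
      simp
  have := congrArg (fun L => L h k) hB
  simpa [B] using this

lemma pf_contDiff {E 𝔸 : Type*} [NormedAddCommGroup E] [NormedSpace ℝ E]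
    [NormedRing 𝔸] [NormedAlgebra ℝ 𝔸] {Ω : Set E} (hΩ : IsOpen Ω)
    (A : E → E →L[ℝ] 𝔸) (hA : ContDiffOn ℝ 1 A Ω) (Φ : E → 𝔸)
    (hΦ : ∀ x ∈ Ω, HasFDerivAt Φ (pfMul (A x) (Φ x)) x) : ContDiffOn ℝ 2 Φ Ω := by
  have hd : DifferentiableOn ℝ Φ Ω := fun x hx =>
    (hΦ x hx).differentiableAt.differentiableWithinAt
  have hstep : ∀ n : WithTop ℕ∞, n ≤ 1 → ContDiffOn ℝ n Φ Ω → ContDiffOn ℝ n (fderiv ℝ Φ) Ω := by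
    intro n hn h
    have h1 : ContDiffOn ℝ n (fun x => pfMul (A x) (Φ x)) Ω := by
      unfold pfMul
      exact (((ContinuousLinearMap.mul ℝ 𝔸).flip.contDiff.comp_contDiffOn h)).clm_comp
        (hA.of_le hn)
    exact h1.congr fun x hx => (hΦ x hx).fderiv
  have h1 : ContDiffOn ℝ 1 Φ Ω := by
    have := (contDiffOn_succ_iff_fderiv_of_isOpen (n := 0) (𝕜 := ℝ) (f := Φ) hΩ).2
      ⟨hd, by simp, hstep 0 (by simp) (contDiffOn_zero.2 hd.continuousOn)⟩
    simpa using this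
  have := (contDiffOn_succ_iff_fderiv_of_isOpen (n := 1) (𝕜 := ℝ) (f := Φ) hΩ).2
      ⟨hd, by simp, hstep 1 le_rfl h1⟩
  simpa [one_add_one_eq_two] using this

lemma pf_frame {Ω : Set E3} (hΩ : IsOpen Ω) (hsc : SimplyConnectedSpace Ω)
    (G : Fin 3 → Fin 3 → Fin 3 → E3 → ℝ)
    (hG : ∀ γ α β, ContDiffOn ℝ 1 (G γ α β) Ω)
    (hsymm : ∀ x ∈ Ω, ∀ γ α β, G γ α β x = G γ β α x)
    (hcurv : ∀ x ∈ Ω, ∀ μ α β ρ : Fin 3,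
      pd ρ (G μ α β) x - pd β (G μ α ρ) x +
        (∑ γ, (G μ γ ρ x * G γ α β x - G μ γ β x * G γ α ρ x)) = 0)
    (x0 : E3) (hx0 : x0 ∈ Ω) (f0 : E3) :
    ∃ (f : E3 → E3) (g : E3 → ℝ), f x0 = f0 ∧ ContDiffOn ℝ 2 g Ω ∧
      (∀ x ∈ Ω, ∀ α, HasFDerivAt (fun z => f z α)
        (∑ ρ, (∑ γ, G γ α ρ x * f x γ) • pfp ρ) x) ∧
      (∀ x ∈ Ω, HasFDerivAt g (∑ ρ, f x ρ • pfp ρ) x) := by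
  obtain ⟨Φ, hΦ0, hΦ⟩ := pf_global hΩ hsc (pfA G) (pfA_contDiffOn G hG)
    (pfA_flat hΩ G hG hsymm hcurv) x0 hx0
  have hΦ2 := pf_contDiff hΩ _ (pfA_contDiffOn G hG) Φ hΦ
  have hu : ∀ x ∈ Ω, HasFDerivAt (fun z => Φ z (f0, 0))
      ((ContinuousLinearMap.apply ℝ PfV ((f0, 0) : PfV)).comp (pfMul (pfA G x) (Φ x))) x :=
    fun x hx => (ContinuousLinearMap.hasFDerivAt
      (ContinuousLinearMap.apply ℝ PfV ((f0, 0) : PfV))).comp x (hΦ x hx)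
  refine ⟨fun x => (Φ x (f0, 0)).1, fun x => (Φ x (f0, 0)).2, by simp [hΦ0], ?_, ?_, ?_⟩
  · exact (hΦ2.clm_apply contDiffOn_const).snd
  · intro x hx α
    have h1 := ((pfp α).comp (ContinuousLinearMap.fst ℝ E3 ℝ)).hasFDerivAt.comp x (hu x hx)
    refine HasFDerivAt.congr_fderiv (f := fun z => (Φ z (f0, 0)).1 α) h1 ?_
    refine ContinuousLinearMap.ext fun h => ?_
    simp [pfA_apply, ContinuousLinearMap.sum_apply, Finset.sum_mul]
    refine Finset.sum_congr rfl fun β _ => Finset.sum_congr rfl fun γ _ => by ring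
  · intro x hx
    have h1 := (ContinuousLinearMap.snd ℝ E3 ℝ).hasFDerivAt.comp x (hu x hx)
    refine HasFDerivAt.congr_fderiv (f := fun z => (Φ z (f0, 0)).2) h1 ?_
    refine ContinuousLinearMap.ext fun h => ?_
    simp [pfA_apply, ContinuousLinearMap.sum_apply, mul_comm]

end Frame

section Final

lemma pf_inv_contDiffOn {Ω : Set E3} (C : E3 → Matrix (Fin 3) (Fin 3) ℝ)
    (hreg : ∀ a b, ContDiffOn ℝ 2 (fun x => C x a b) Ω)
    (hpos : ∀ x ∈ Ω, (C x).PosDef) (a b : Fin 3) :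
    ContDiffOn ℝ 2 (fun x => (C x)⁻¹ a b) Ω := by
  have hdet : ContDiffOn ℝ 2 (fun x => (C x).det) Ω := by
    simp only [Matrix.det_fin_three]
    fun_prop (disch := assumption)
  have hadj : ContDiffOn ℝ 2 (fun x => (C x).adjugate a b) Ω := by
    simp only [Matrix.adjugate_fin_three]
    fin_cases a <;> fin_cases b <;> simp <;> fun_prop (disch := assumption)
  have := (hdet.inv fun x hx => (hpos x hx).det_pos.ne').mul hadj
  refine this.congr fun x hx => ?_
  simp [Matrix.inv_def, Ring.inverse_eq_inv']

lemma pf_pd_contDiffOn {Ω : Set E3} (hΩ : IsOpen Ω) {f : E3 → ℝ} (hf : ContDiffOn ℝ 2 f Ω)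
    (j : Fin 3) : ContDiffOn ℝ 1 (pd j f) Ω := by
  have h := hf.fderiv_of_isOpen (m := 1) hΩ (by norm_num [one_add_one_eq_two])
  exact h.clm_apply contDiffOn_const

lemma pf_chr_contDiffOn {Ω : Set E3} (hΩ : IsOpen Ω) (C : E3 → Matrix (Fin 3) (Fin 3) ℝ)
    (hreg : ∀ a b, ContDiffOn ℝ 2 (fun x => C x a b) Ω)
    (hpos : ∀ x ∈ Ω, (C x).PosDef) (γ α β : Fin 3) :
    ContDiffOn ℝ 1 (christoffel C γ α β) Ω := by
  unfold christoffel
  refine contDiffOn_const.mul (ContDiffOn.sum fun μ _ => ?_)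
  refine ((pf_inv_contDiffOn C hreg hpos γ μ).of_le (by norm_num)).mul ?_
  exact ((pf_pd_contDiffOn hΩ (hreg _ _) _).add (pf_pd_contDiffOn hΩ (hreg _ _) _)).sub
    (pf_pd_contDiffOn hΩ (hreg _ _) _)

lemma pf_pd_symm {Ω : Set E3} (hΩ : IsOpen Ω) (C : E3 → Matrix (Fin 3) (Fin 3) ℝ)
    (hsym : ∀ x ∈ Ω, (C x).IsSymm) (μ α β : Fin 3) (x : E3) (hx : x ∈ Ω) :
    pd μ (fun y => C y α β) x = pd μ (fun y => C y β α) x := by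
  unfold pd
  have : (fun y => C y α β) =ᶠ[𝓝 x] (fun y => C y β α) := by
    filter_upwards [hΩ.mem_nhds hx] with z hz
    exact (hsym z hz).apply β α
  rw [this.fderiv_eq]

lemma pf_chr_symm {Ω : Set E3} (hΩ : IsOpen Ω) (C : E3 → Matrix (Fin 3) (Fin 3) ℝ)
    (hsym : ∀ x ∈ Ω, (C x).IsSymm) (x : E3) (hx : x ∈ Ω) (γ α β : Fin 3) :
    christoffel C γ α β x = christoffel C γ β α x := by
  unfold christoffel
  congr 1
  refine Finset.sum_congr rfl fun μ _ => ?_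
  rw [pf_pd_symm hΩ C hsym μ α β x hx]
  ring

lemma pf_chr_low (C : E3 → Matrix (Fin 3) (Fin 3) ℝ) (x : E3) (hp : (C x).PosDef)
    (hs : (C x).IsSymm) (α β ρ : Fin 3) :
    ∑ γ, christoffel C γ α ρ x * C x γ β = (1 / 2) *
      (pd ρ (fun y => C y α β) x + pd α (fun y => C y ρ β) x - pd β (fun y => C y α ρ) x) := by
  have hi : C x * (C x)⁻¹ = 1 := Matrix.mul_nonsing_inv _ hp.det_pos.ne'.isUnit
  have hi' : ∀ μ, ∑ γ, C x γ β * (C x)⁻¹ γ μ = if β = μ then 1 else 0 := by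
    intro μ
    have := congrFun (congrFun hi β) μ
    rw [Matrix.mul_apply, Matrix.one_apply] at this
    rw [← this]
    exact Finset.sum_congr rfl fun γ _ => by rw [hs.apply]
  set P : Fin 3 → ℝ := fun μ =>
    pd ρ (fun y => C y α μ) x + pd α (fun y => C y ρ μ) x - pd μ (fun y => C y α ρ) x with hP
  have : ∑ γ, christoffel C γ α ρ x * C x γ β =
      (1 / 2) * ∑ μ, (∑ γ, C x γ β * (C x)⁻¹ γ μ) * P μ := by
    unfold christoffel
    simp only [Finset.sum_mul, Finset.mul_sum]
    rw [Finset.sum_comm]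
    refine Finset.sum_congr rfl fun μ _ => Finset.sum_congr rfl fun γ _ => ?_
    simp only [hP]; ring
  rw [this]
  simp [hi', hP]

lemma pf_metric {Ω : Set E3} (hΩ : IsOpen Ω) (C : E3 → Matrix (Fin 3) (Fin 3) ℝ)
    (hpos : ∀ x ∈ Ω, (C x).PosDef) (hsym : ∀ x ∈ Ω, (C x).IsSymm) (x : E3) (hx : x ∈ Ω)
    (α β ρ : Fin 3) :
    pd ρ (fun y => C y α β) x = ∑ γ, (christoffel C γ α ρ x * C x γ β +
      christoffel C γ β ρ x * C x α γ) := by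
  have h1 := pf_chr_low C x (hpos x hx) (hsym x hx) α β ρ
  have h2 := pf_chr_low C x (hpos x hx) (hsym x hx) β α ρ
  have h3 : ∀ γ, C x α γ = C x γ α := fun γ => (hsym x hx).apply γ α
  simp only [h3, Finset.sum_add_distrib]
  rw [h1, h2, pf_pd_symm hΩ C hsym ρ β α x hx, pf_pd_symm hΩ C hsym α ρ β x hx,
    pf_pd_symm hΩ C hsym β ρ α x hx]
  ring

lemma pf_root (M : Matrix (Fin 3) (Fin 3) ℝ) (hM : M.PosDef) :
    ∃ F : Matrix (Fin 3) (Fin 3) ℝ, Fᵀ * F = M ∧ 0 < F.det := by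
  obtain ⟨B, hB⟩ : ∃ B : Matrix (Fin 3) (Fin 3) ℝ, M = Bᵀ * B := by
    open scoped MatrixOrder Matrix.Norms.L2Operator in
    obtain ⟨B, hB⟩ := CStarAlgebra.nonneg_iff_eq_star_mul_self.mp hM.posSemidef.nonneg
    exact ⟨B, by simpa [Matrix.star_eq_conjTranspose] using hB⟩
  have hd : B.det * B.det = M.det := by rw [hB, Matrix.det_mul, Matrix.det_transpose]
  have hp := hM.det_pos
  have hne : B.det ≠ 0 := by rintro h; rw [h] at hd; simp at hd; linarith
  rcases lt_or_gt_of_ne hne with h | h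
  · refine ⟨-B, by simp [hB], ?_⟩
    rw [Matrix.det_neg]; simp; 
    norm_num [Odd.neg_one_pow]; exact h
  · exact ⟨B, hB.symm, h⟩

lemma pf_lin (L : E3 →L[ℝ] ℝ) : L = ∑ ρ, L (Pi.single ρ 1) • pfp ρ := by
  refine ContinuousLinearMap.ext fun h => ?_
  conv_lhs => rw [show h = ∑ ρ, h ρ • (Pi.single ρ 1 : E3) from by
    simpa using (pi_eq_sum_univ' h)]
  simp [map_sum, mul_comm]

lemma pf_gram {Ω : Set E3} (hΩ : IsOpen Ω) (hconn : IsPreconnected Ω)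
    (C : E3 → Matrix (Fin 3) (Fin 3) ℝ)
    (hreg : ∀ a b, ContDiffOn ℝ 2 (fun x => C x a b) Ω)
    (G : Fin 3 → Fin 3 → Fin 3 → E3 → ℝ)
    (hG : ∀ γ α β, ContinuousOn (G γ α β) Ω)
    (hC : ∀ x ∈ Ω, ∀ α β ρ, pd ρ (fun y => C y α β) x =
      ∑ γ, (G γ α ρ x * C x γ β + G γ β ρ x * C x α γ))
    (f : Fin 3 → E3 → E3)
    (hf : ∀ i, ∀ x ∈ Ω, ∀ α, HasFDerivAt (fun z => f i z α)
        (∑ ρ, (∑ γ, G γ α ρ x * f i x γ) • pfp ρ) x)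
    (x0 : E3) (hx0 : x0 ∈ Ω) (h0 : ∀ α β, ∑ i, f i x0 α * f i x0 β = C x0 α β) :
    ∀ x ∈ Ω, ∀ α β, ∑ i, f i x α * f i x β = C x α β := by
  let u : E3 → Fin 3 → Fin 3 → ℝ := fun x α β => ∑ i, f i x α * f i x β - C x α β
  let c : E3 → Fin 3 → Fin 3 → Fin 3 → ℝ := fun x α β ρ =>
    ∑ γ, (G γ α ρ x * u x γ β + G γ β ρ x * u x α γ)
  let u' : E3 → E3 →L[ℝ] (Fin 3 → Fin 3 → ℝ) := fun x =>
    ContinuousLinearMap.pi fun α => ContinuousLinearMap.pi fun β => ∑ ρ, c x α β ρ • pfp ρ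
  let k : E3 → Fin 3 → Fin 3 → ℝ := fun x α β => ∑ ρ, ∑ γ, (|G γ α ρ x| + |G γ β ρ x|)
  let K : E3 → ℝ := fun x => ∑ α, ∑ β, k x α β
  have hk0 : ∀ x α β, 0 ≤ k x α β := fun x α β =>
    Finset.sum_nonneg fun _ _ => Finset.sum_nonneg fun _ _ => by positivity
  have hkK : ∀ x α β, k x α β ≤ K x := fun x α β =>
    (Finset.single_le_sum (f := fun β => k x α β) (fun b _ => hk0 x α b)
      (Finset.mem_univ β)).trans
    (Finset.single_le_sum (f := fun α => ∑ β, k x α β)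
      (fun a _ => Finset.sum_nonneg fun b _ => hk0 x a b) (Finset.mem_univ α))
  have hK : ContinuousOn K Ω := by
    refine continuousOn_finset_sum _ fun α _ => continuousOn_finset_sum _ fun β _ =>
      continuousOn_finset_sum _ fun ρ _ => continuousOn_finset_sum _ fun γ _ => ?_
    exact (hG _ _ _).abs.add (hG _ _ _).abs
  have hu : ∀ x ∈ Ω, HasFDerivAt u (u' x) x := by
    intro x hx
    refine hasFDerivAt_pi.2 fun α => hasFDerivAt_pi.2 fun β => ?_
    have h1 := (HasFDerivAt.fun_sum (u := Finset.univ) fun i _ =>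
      (hf i x hx α).mul (hf i x hx β)).sub
      ((((hreg α β).differentiableOn (by norm_num)).differentiableAt
        (hΩ.mem_nhds hx)).hasFDerivAt)
    refine h1.congr_fderiv ?_
    rw [pf_lin (fderiv ℝ (fun x => C x α β) x)]
    have hCx : ∀ ρ, fderiv ℝ (fun x => C x α β) x (Pi.single ρ 1) =
      ∑ γ, (G γ α ρ x * C x γ β + G γ β ρ x * C x α γ) := hC x hx α β
    simp only [hCx]
    refine ContinuousLinearMap.ext fun h => ?_
    simp only [c, u, Fin.sum_univ_three]
    simp
    ring
  have hb : ∀ x ∈ Ω, ‖u' x‖ ≤ K x * ‖u x‖ := by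
    intro x hx
    have hK0 : 0 ≤ K x := (hk0 x 0 0).trans (hkK x 0 0)
    refine ContinuousLinearMap.opNorm_le_bound _ (mul_nonneg hK0 (norm_nonneg _)) fun h => ?_
    have hR : 0 ≤ K x * ‖u x‖ * ‖h‖ :=
      mul_nonneg (mul_nonneg hK0 (norm_nonneg _)) (norm_nonneg _)
    refine (pi_norm_le_iff_of_nonneg hR).2 fun α => (pi_norm_le_iff_of_nonneg hR).2 fun β => ?_
    have hub : ∀ a b, |u x a b| ≤ ‖u x‖ := fun a b =>
      (norm_le_pi_norm (u x a) b).trans (norm_le_pi_norm (u x) a)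
    have hhb : ∀ r, |h r| ≤ ‖h‖ := fun r => norm_le_pi_norm h r
    have e : u' x h α β = ∑ ρ, c x α β ρ * h ρ := by
      simp [u']
    rw [e, Real.norm_eq_abs]
    have hstep : |∑ ρ, c x α β ρ * h ρ| ≤ k x α β * ‖u x‖ * ‖h‖ := by
      simp only [k, Finset.sum_mul]
      refine (Finset.abs_sum_le_sum_abs _ _).trans (Finset.sum_le_sum fun ρ _ => ?_)
      rw [abs_mul]
      simp only [← Finset.sum_mul]
      refine mul_le_mul ?_ (hhb ρ) (abs_nonneg _) (mul_nonneg
        (Finset.sum_nonneg fun _ _ => add_nonneg (abs_nonneg _) (abs_nonneg _)) (norm_nonneg _))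
      simp only [c, Finset.sum_mul]
      refine (Finset.abs_sum_le_sum_abs _ _).trans (Finset.sum_le_sum fun γ _ => ?_)
      refine (abs_add_le _ _).trans ?_
      rw [abs_mul, abs_mul, add_mul]
      exact add_le_add (mul_le_mul_of_nonneg_left (hub _ _) (abs_nonneg _))
        (mul_le_mul_of_nonneg_left (hub _ _) (abs_nonneg _))
    refine hstep.trans ?_
    exact mul_le_mul_of_nonneg_right
      (mul_le_mul_of_nonneg_right (hkK x α β) (norm_nonneg _)) (norm_nonneg _)
  have hz := pf_unique hΩ hconn u u' K hK hu hb hx0 (by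
    funext α β
    simp [u, h0])
  intro x hx α β
  have := congrFun (congrFun (hz x hx) α) β
  simpa [u, sub_eq_zero] using this

lemma pf_main (Ω : Set E3) (hΩ : IsOpen Ω) (hconn : IsConnected Ω)
    (hsc : SimplyConnectedSpace Ω)
    (C : E3 → Matrix (Fin 3) (Fin 3) ℝ)
    (hreg : ∀ a b, ContDiffOn ℝ 2 (fun x => C x a b) Ω)
    (hpos : ∀ x ∈ Ω, (C x).PosDef)
    (hsym : ∀ x ∈ Ω, (C x).IsSymm)
    (hcurv : ∀ x ∈ Ω, ∀ μ α β ρ : Fin 3,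
      pd ρ (christoffel C μ α β) x - pd β (christoffel C μ α ρ) x +
        (∑ γ, (christoffel C μ γ ρ x * christoffel C γ α β x -
               christoffel C μ γ β x * christoffel C γ α ρ x)) = 0) :
    ∃ y : E3 → E3, ContDiffOn ℝ 2 y Ω ∧
      (∀ x ∈ Ω, 0 < (jac y x).det) ∧
      (∀ x ∈ Ω, (jac y x)ᵀ * jac y x = C x) := by
  obtain ⟨x0, hx0⟩ := hconn.nonempty
  obtain ⟨F, hF, hFd⟩ := pf_root (C x0) (hpos x0 hx0)
  have hG := pf_chr_contDiffOn hΩ C hreg hpos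
  choose f g hf0 hg hf hgd using fun i : Fin 3 => pf_frame hΩ hsc (christoffel C) hG
    (pf_chr_symm hΩ C hsym) hcurv x0 hx0 (F i)
  have hgram := pf_gram hΩ hconn.isPreconnected C hreg (christoffel C)
    (fun γ α β => (hG γ α β).continuousOn) (pf_metric hΩ C hpos hsym) f hf x0 hx0 (by
      intro α β
      rw [← hF, Matrix.mul_apply]
      simp [hf0])
  have hjac : ∀ x ∈ Ω, jac (fun x i => g i x) x = Matrix.of fun i α => f i x α := by
    intro x hx
    ext i α
    simp only [jac, Matrix.of_apply, pd]
    rw [(hgd i x hx).fderiv]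
    simp [Pi.single_apply]
  have hjj : ∀ x ∈ Ω, (jac (fun x i => g i x) x)ᵀ * jac (fun x i => g i x) x = C x := by
    intro x hx
    rw [hjac x hx]
    ext α β
    rw [Matrix.mul_apply, ← hgram x hx α β]
    simp
  refine ⟨fun x i => g i x, contDiffOn_pi.2 fun i => hg i, ?_, hjj⟩
  have hne : ∀ x ∈ Ω, (jac (fun x i => g i x) x).det ≠ 0 := by
    intro x hx h
    have h1 := congrArg Matrix.det (hjj x hx)
    rw [Matrix.det_mul, h, mul_zero] at h1
    exact (hpos x hx).det_pos.ne h1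
  have hcont : ContinuousOn (fun x => (jac (fun x i => g i x) x).det) Ω := by
    have h1 : ∀ i α, ContinuousOn (fun x => f i x α) Ω := fun i α x hx =>
      (hf i x hx α).continuousAt.continuousWithinAt
    refine ContinuousOn.congr (f := fun x => (Matrix.of fun i α => f i x α).det) ?_
      fun x hx => by rw [hjac x hx]
    simp only [Matrix.det_fin_three, Matrix.of_apply]
    fun_prop (disch := assumption)
  have hstart : 0 < (jac (fun x i => g i x) x0).det := by
    rw [hjac x0 hx0]
    have : (Matrix.of fun i α => f i x0 α) = F := by
      ext i α; simp [hf0]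
    rw [this]; exact hFd
  intro x hx
  by_contra hlt
  have hivt := hconn.isPreconnected.intermediate_value hx hx0 hcont
  obtain ⟨z, hz, hz0⟩ := hivt ⟨not_lt.1 hlt, hstart.le⟩
  exact hne z hz hz0

end Final

end PfHelpers

/-- On a connected, simply connected open set `Ω ⊆ ℝ³`, a C² positive-definite symmetric
matrix field `C` with vanishing Riemann–Christoffel curvature is the right Cauchy–Green
field of some C² deformation `y` with `det Dy > 0` on `Ω`. -/
theorem weingarten_stmt15 (Ω : Set E3) (hΩ : IsOpen Ω) (hconn : IsConnected Ω)
    (hsc : SimplyConnectedSpace Ω)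
    (C : E3 → Matrix (Fin 3) (Fin 3) ℝ)
    (hreg : ∀ a b, ContDiffOn ℝ 2 (fun x => C x a b) Ω)
    (hpos : ∀ x ∈ Ω, (C x).PosDef)
    (hsym : ∀ x ∈ Ω, (C x).IsSymm)
    (hcurv : ∀ x ∈ Ω, ∀ μ α β ρ : Fin 3,
      pd ρ (christoffel C μ α β) x - pd β (christoffel C μ α ρ) x +
        (∑ γ, (christoffel C μ γ ρ x * christoffel C γ α β x -
               christoffel C μ γ β x * christoffel C γ α ρ x)) = 0) :
    ∃ y : E3 → E3, ContDiffOn ℝ 2 y Ω ∧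
      (∀ x ∈ Ω, 0 < (jac y x).det) ∧
      (∀ x ∈ Ω, (jac y x)ᵀ * jac y x = C x) := by
  exact pf_main Ω hΩ hconn hsc C hreg hpos hsym hcurv
end
end
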